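/- arXiv:1503.06112 — 11 statements merged into one kernel-verified Lean document; each statement's English description precedes it below -/
import Mathlib

section
/- Let X be a Banach space, Y ⊆ X a closed linear subspace, and q : X → X/Y the quotient map. Then Y is proximinal in X if and only if q maps the closed unit ball of X onto the closed unit ball of X/Y, i.e. q(B_X) = B_{X/Y}. -/
/-- A set `F` in a normed space is *proximinal* if for every `x` there exists `y ∈ F` with
`‖x - y‖ = dist(x, F)`. -/
def IsProximinal {X : Type*} [SeminormedAddCommGroup X] (F : Set X) : Prop :=
  ∀ x : X, ∃ y ∈ F, ‖x - y‖ = Metric.infDist x F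

/-- Let `X` be a Banach space, `Y ⊆ X` a closed linear subspace and
`q : X → X ⧸ Y` the quotient map.  Then `Y` is proximinal in `X` if and only if
`q` maps the closed unit ball of `X` onto the closed unit ball of `X ⧸ Y`. -/
theorem stmt0 {X : Type*} [NormedAddCommGroup X] [NormedSpace ℝ X] [CompleteSpace X]
    (Y : Submodule ℝ X) [IsClosed (Y : Set X)] :
    IsProximinal (Y : Set X) ↔
      (Submodule.Quotient.mk (p := Y)) '' Metric.closedBall (0 : X) 1 =
        Metric.closedBall (0 : X ⧸ Y) 1 := by
  have hn : ∀ x : X, ‖(Submodule.Quotient.mk x : X ⧸ Y)‖ = Metric.infDist x (Y : Set X) :=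
    fun x => QuotientAddGroup.norm_mk (S := Y.toAddSubgroup) x
  constructor
  · intro h
    apply Set.Subset.antisymm
    · rintro _ ⟨x, hx, rfl⟩
      rw [mem_closedBall_zero_iff] at hx ⊢
      exact (Submodule.Quotient.norm_mk_le Y x).trans hx
    · intro u hu
      obtain ⟨x, rfl⟩ := Submodule.Quotient.mk_surjective Y u
      obtain ⟨y, hy, hxy⟩ := h x
      rw [mem_closedBall_zero_iff, hn] at hu
      refine ⟨x - y, ?_, ?_⟩
      · rw [mem_closedBall_zero_iff, hxy]
        exact hu
      · rw [Submodule.Quotient.eq]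
        have e : x - y - x = -y := by abel
        rw [e]
        exact Y.neg_mem hy
  · intro h x
    by_cases hd : Metric.infDist x (Y : Set X) = 0
    · have hx : x ∈ (Y : Set X) :=
        (IsClosed.mem_iff_infDist_zero (by assumption) ⟨0, Y.zero_mem⟩).2 hd
      exact ⟨x, hx, by simp [hd]⟩
    · set d := Metric.infDist x (Y : Set X) with hdd
      have hpos : 0 < d := lt_of_le_of_ne Metric.infDist_nonneg (Ne.symm hd)
      have hm : (Submodule.Quotient.mk (d⁻¹ • x) : X ⧸ Y) ∈ Metric.closedBall (0 : X ⧸ Y) 1 := by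
        rw [mem_closedBall_zero_iff, Submodule.Quotient.mk_smul, norm_smul, hn, ← hdd,
          Real.norm_of_nonneg (inv_nonneg.2 hpos.le), inv_mul_cancel₀ hd]
      rw [← h] at hm
      obtain ⟨z, hz, hzx⟩ := hm
      rw [mem_closedBall_zero_iff] at hz
      rw [Submodule.Quotient.eq] at hzx
      have hy : x - d • z ∈ Y := by
        have := Y.smul_mem (-d) hzx
        rwa [smul_sub, smul_smul, neg_mul, mul_inv_cancel₀ hd, neg_smul, neg_smul, one_smul,
          sub_neg_eq_add, add_comm, ← sub_eq_add_neg] at this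
      refine ⟨x - d • z, hy, le_antisymm ?_ ?_⟩
      · rw [sub_sub_cancel, norm_smul, Real.norm_of_nonneg hpos.le]
        exact mul_le_of_le_one_right hpos.le hz
      · rw [← dist_eq_norm]
        exact Metric.infDist_le_dist_of_mem hy
end

section
/- Let X be a Banach space and Y ⊆ X a closed linear subspace such that the quotient space X/Y is reflexive. If Y is proximinal in X, then Y⊥ ⊆ NA(X). -/
/-- `NA(X)`: the set of norm-attaining continuous linear functionals on `X`. -/
def NormAttaining (X : Type*) [SeminormedAddCommGroup X] [NormedSpace ℝ X] :
    Set (X →L[ℝ] ℝ) :=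
  {f | ∃ x ∈ Metric.closedBall (0 : X) 1, f x = ‖f‖}

/-- Let `X` be a Banach space and `Y ⊆ X` a closed linear subspace such that
the quotient `X ⧸ Y` is reflexive (the canonical embedding into its bidual is surjective).
If `Y` is proximinal in `X`, then `Y⊥ ⊆ NA(X)`. -/
theorem stmt2 {X : Type*} [NormedAddCommGroup X] [NormedSpace ℝ X] [CompleteSpace X]
    (Y : Submodule ℝ X) [IsClosed (Y : Set X)]
    (hrefl : Function.Surjective (NormedSpace.inclusionInDoubleDual ℝ (X ⧸ Y)))
    (hprox : IsProximinal (Y : Set X)) :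
    {f : X →L[ℝ] ℝ | ∀ y ∈ Y, f y = 0} ⊆ NormAttaining X := by
  intro f hf
  have key : ∀ q : X ⧸ Y, ∃ z : X, Submodule.Quotient.mk z = q ∧ ‖z‖ = ‖q‖ := by
    intro q
    obtain ⟨x, rfl⟩ := Submodule.Quotient.mk_surjective Y q
    obtain ⟨y, hy, hxy⟩ := hprox x
    refine ⟨x - y, ?_, ?_⟩
    · rw [Submodule.Quotient.eq]
      simpa using hy
    · rw [hxy]
      exact (QuotientAddGroup.norm_mk (S := Y.toAddSubgroup) x).symm
  have hle : Y ≤ LinearMap.ker (f : X →ₗ[ℝ] ℝ) := fun y hy => hf y hy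
  let g : StrongDual ℝ (X ⧸ Y) := LinearMap.mkContinuous (Y.liftQ (f : X →ₗ[ℝ] ℝ) hle) ‖f‖ (by
    intro q
    obtain ⟨z, rfl, hz⟩ := key q
    rw [← hz]
    exact f.le_opNorm z)
  have hg : ∀ x : X, g (Submodule.Quotient.mk x) = f x := fun x => rfl
  have hfg : ‖f‖ ≤ ‖g‖ := by
    refine f.opNorm_le_bound (norm_nonneg g) fun x => ?_
    rw [← hg]
    refine (g.le_opNorm _).trans ?_
    gcongr
    exact Submodule.Quotient.norm_mk_le Y x
  have hgf : ‖g‖ ≤ ‖f‖ := LinearMap.mkContinuous_norm_le _ (norm_nonneg f) _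
  obtain ⟨φ, hφ, hφg⟩ := exists_dual_vector'' ℝ g
  obtain ⟨q, rfl⟩ := hrefl φ
  have hq : ‖q‖ ≤ 1 := by
    rw [← (NormedSpace.inclusionInDoubleDualLi ℝ (E := X ⧸ Y)).norm_map q]
    exact hφ
  obtain ⟨z, rfl, hz⟩ := key q
  refine ⟨z, ?_, ?_⟩
  · rw [mem_closedBall_zero_iff, hz]
    exact hq
  · rw [NormedSpace.dual_def, hg] at hφg
    rw [hφg]
    exact le_antisymm hgf hfg
end

section
/- Let X be a Banach space and Y ⊆ X a closed linear subspace such that the quotient space X/Y is strictly convex. If Y⊥ ⊆ NA(X), then Y is proximinal in X. -/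
/-- Let `X` be a Banach space and `Y ⊆ X` a closed linear subspace such that
the quotient `X ⧸ Y` is strictly convex.  If `Y⊥ ⊆ NA(X)`, then `Y` is proximinal in `X`. -/
theorem stmt3 {X : Type*} [NormedAddCommGroup X] [NormedSpace ℝ X] [CompleteSpace X]
    (Y : Submodule ℝ X) [IsClosed (Y : Set X)]
    (hsc : StrictConvexSpace ℝ (X ⧸ Y))
    (hNA : {f : X →L[ℝ] ℝ | ∀ y ∈ Y, f y = 0} ⊆ NormAttaining X) :
    IsProximinal (Y : Set X) := by
  haveI := hsc
  intro x
  have hnorm : ‖(Submodule.Quotient.mk x : X ⧸ Y)‖ = Metric.infDist x (Y : Set X) :=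
    QuotientAddGroup.norm_mk (S := Y.toAddSubgroup) x
  rw [← hnorm]
  by_cases hz : ‖(Submodule.Quotient.mk x : X ⧸ Y)‖ = 0
  · refine ⟨x, ?_, by simp [hz]⟩
    have h0 : (Submodule.Quotient.mk x : X ⧸ Y) = 0 := norm_eq_zero.mp hz
    exact (Submodule.Quotient.mk_eq_zero Y).mp h0
  obtain ⟨g, hg1, hgz⟩ := exists_dual_vector ℝ (Submodule.Quotient.mk x : X ⧸ Y) hz
  have hnp : 0 < ‖(Submodule.Quotient.mk x : X ⧸ Y)‖ :=
    lt_of_le_of_ne (norm_nonneg _) (Ne.symm hz)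
  have hgz' : g (Submodule.Quotient.mk x : X ⧸ Y) = ‖(Submodule.Quotient.mk x : X ⧸ Y)‖ := hgz
  have hgle : ∀ w : X ⧸ Y, g w ≤ ‖w‖ := fun w => by
    have := (le_abs_self (g w)).trans (g.le_opNorm w)
    rwa [hg1, one_mul] at this
  have hfm : ∀ m : X, (g.comp Y.mkQL) m = g (Submodule.Quotient.mk m) := fun m => rfl
  obtain ⟨u, hu, hfu⟩ := hNA (show g.comp Y.mkQL ∈ {f : X →L[ℝ] ℝ | ∀ y ∈ Y, f y = 0} from
    fun y hy => by rw [hfm, (Submodule.Quotient.mk_eq_zero Y).mpr hy, map_zero])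
  rw [hfm] at hfu
  have hu1 : ‖u‖ ≤ 1 := by simpa using hu
  generalize hN : ‖g.comp Y.mkQL‖ = N at hfu
  have hN0 : 0 ≤ N := hN ▸ norm_nonneg _
  have hq : ‖(Submodule.Quotient.mk u : X ⧸ Y)‖ ≤ ‖u‖ := Submodule.Quotient.norm_mk_le Y u
  have hN1 : 1 ≤ N := by
    by_contra hlt
    push Not at hlt
    have hε : 0 < (1 - N) * ‖(Submodule.Quotient.mk x : X ⧸ Y)‖ :=
      mul_pos (by linarith) hnp
    obtain ⟨m, hm, hmlt⟩ := Submodule.Quotient.norm_mk_lt (Submodule.Quotient.mk x : X ⧸ Y) hε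
    have h1 : g (Submodule.Quotient.mk m) ≤ N * ‖m‖ := by
      have := (le_abs_self _).trans ((g.comp Y.mkQL).le_opNorm m)
      rwa [hN, hfm] at this
    rw [hm, hgz'] at h1
    have h2 : N * ‖m‖ ≤ N * (‖(Submodule.Quotient.mk x : X ⧸ Y)‖ +
      (1 - N) * ‖(Submodule.Quotient.mk x : X ⧸ Y)‖) := mul_le_mul_of_nonneg_left hmlt.le hN0
    nlinarith [mul_pos (mul_pos (sub_pos.mpr hlt) (sub_pos.mpr hlt)) hnp]
  generalize hzz : (Submodule.Quotient.mk x : X ⧸ Y) = z at *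
  generalize hww : (Submodule.Quotient.mk u : X ⧸ Y) = w at *
  have hw : ‖w‖ = 1 := le_antisymm (hq.trans hu1) (by linarith [hgle w])
  have hnw : ‖‖z‖ • w‖ = ‖z‖ := by rw [norm_smul, hw]; simp
  have hadd : ‖‖z‖ • w + z‖ = ‖‖z‖ • w‖ + ‖z‖ := by
    refine le_antisymm (norm_add_le _ _) ?_
    have h := hgle (‖z‖ • w + z)
    rw [map_add, map_smul, smul_eq_mul, hfu, hgz'] at h
    rw [hnw]
    nlinarith
  have heq : ‖z‖ • w = z := eq_of_norm_eq_of_norm_add_eq hnw hadd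
  refine ⟨x - ‖z‖ • u, ?_, ?_⟩
  · apply (Submodule.Quotient.mk_eq_zero Y).mp
    rw [Submodule.Quotient.mk_sub, Submodule.Quotient.mk_smul, hzz, hww, heq, sub_self]
  · rw [sub_sub_cancel, norm_smul, norm_norm, le_antisymm hu1 (hw ▸ hq), mul_one]
end

section
/- Let X be a Banach space and Y ⊆ X a closed linear subspace of finite codimension in X. If Y is proximinal in X, then Y⊥ ⊆ NA(X). -/
/-- Let `X` be a Banach space and `Y ⊆ X` a closed linear subspace of finite
codimension (i.e. `X ⧸ Y` is finite-dimensional).  If `Y` is proximinal in `X`, then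
`Y⊥ ⊆ NA(X)`. -/
theorem stmt4 {X : Type*} [NormedAddCommGroup X] [NormedSpace ℝ X] [CompleteSpace X]
    (Y : Submodule ℝ X) [IsClosed (Y : Set X)] [FiniteDimensional ℝ (X ⧸ Y)]
    (hprox : IsProximinal (Y : Set X)) :
    {f : X →L[ℝ] ℝ | ∀ y ∈ Y, f y = 0} ⊆ NormAttaining X := by
  intro f hf
  have hf' : Y ≤ LinearMap.ker (f : X →ₗ[ℝ] ℝ) := fun y hy => by
    simpa using hf y hy
  let g : (X ⧸ Y) →ₗ[ℝ] ℝ := Y.liftQ (f : X →ₗ[ℝ] ℝ) hf'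
  have hg : ∀ x : X, g (Submodule.Quotient.mk x) = f x := fun x => by
    simp [g]
  have hgc : Continuous g := g.continuous_of_finiteDimensional
  haveI : ProperSpace (X ⧸ Y) := FiniteDimensional.proper ℝ (X ⧸ Y)
  obtain ⟨q, hq, hmax⟩ := (isCompact_closedBall (0 : X ⧸ Y) 1).exists_isMaxOn
    ⟨0, by simp⟩ hgc.continuousOn
  obtain ⟨x, rfl⟩ := Submodule.Quotient.mk_surjective Y q
  obtain ⟨y, hy, hxy⟩ := hprox x
  have hn : ‖(Submodule.Quotient.mk x : X ⧸ Y)‖ = Metric.infDist x (Y : Set X) :=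
    QuotientAddGroup.norm_mk (S := Y.toAddSubgroup) x
  have hz : ‖x - y‖ ≤ 1 := by
    rw [hxy, ← hn]
    simpa using hq
  have hfz : f (x - y) = f x := by
    rw [map_sub, hf y hy, sub_zero]
  have key : ∀ w : X, ‖w‖ ≤ 1 → f w ≤ f x := fun w hw => by
    have h1 : (Submodule.Quotient.mk w : X ⧸ Y) ∈ Metric.closedBall (0 : X ⧸ Y) 1 := by
      rw [mem_closedBall_zero_iff]
      exact (Submodule.Quotient.norm_mk_le Y w).trans hw
    have h2 := hmax h1
    simpa only [Set.mem_setOf_eq, hg] using h2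
  refine ⟨x - y, by simpa using hz, ?_⟩
  have h0 : 0 ≤ f x := by simpa using key 0 (by simp)
  apply le_antisymm
  · calc f (x - y) ≤ ‖f (x - y)‖ := Real.le_norm_self _
      _ ≤ ‖f‖ * ‖x - y‖ := f.le_opNorm _
      _ ≤ ‖f‖ * 1 := by gcongr
      _ = ‖f‖ := mul_one _
  · rw [hfz]
    apply ContinuousLinearMap.opNorm_le_of_unit_norm h0
    intro w hw
    rw [Real.norm_eq_abs, abs_le]
    have h3 := key (-w) (by simp [hw])
    rw [map_neg] at h3
    exact ⟨by linarith, key w hw.le⟩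
end

section
/- Let X be a Banach space whose norm is weakly locally uniformly rotund (WLUR), and let Y ⊆ X be a closed linear subspace such that Y⊥ ⊆ NA(X). Then the quotient space X/Y is strictly convex. -/
/-- The norm of `X` is *weakly locally uniformly rotund* (WLUR): whenever `‖xₙ‖ → ‖x‖` and
`‖x + xₙ‖ → 2‖x‖`, the sequence `xₙ` converges weakly to `x`. -/
def IsWLUR (X : Type*) [SeminormedAddCommGroup X] [NormedSpace ℝ X] : Prop :=
  ∀ (x : X) (xn : ℕ → X),
    Filter.Tendsto (fun n => ‖xn n‖) Filter.atTop (nhds ‖x‖) →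
    Filter.Tendsto (fun n => ‖x + xn n‖) Filter.atTop (nhds (2 * ‖x‖)) →
    ∀ f : X →L[ℝ] ℝ, Filter.Tendsto (fun n => f (xn n)) Filter.atTop (nhds (f x))

/-- Let `X` be a Banach space whose norm is WLUR and `Y ⊆ X` a closed linear
subspace with `Y⊥ ⊆ NA(X)`.  Then the quotient `X ⧸ Y` is strictly convex. -/
theorem stmt6 {X : Type*} [NormedAddCommGroup X] [NormedSpace ℝ X] [CompleteSpace X]
    (hwlur : IsWLUR X)
    (Y : Submodule ℝ X) [IsClosed (Y : Set X)]
    (hNA : {f : X →L[ℝ] ℝ | ∀ y ∈ Y, f y = 0} ⊆ NormAttaining X) :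
    StrictConvexSpace ℝ (X ⧸ Y) := by
  have key : ∀ g : (X ⧸ Y) →L[ℝ] ℝ, ‖g‖ = 1 → ∃ x : X, ∀ u : X ⧸ Y, ‖u‖ = 1 → g u = 1 →
      u = Y.mkQ x := by
    intro g hg
    let p : X →L[ℝ] X ⧸ Y := Y.mkQ.mkContinuous 1 (fun m => by
      rw [one_mul]; exact Submodule.Quotient.norm_mk_le Y m)
    have hp : ∀ m, p m = Y.mkQ m := fun m => rfl
    obtain ⟨x, hx, hfx⟩ := hNA (a := g.comp p) (by
      intro y hy
      have : Y.mkQ y = 0 := by simpa using hy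
      simp [hp, -Submodule.mkQ_apply, this])
    have hx1 : ‖x‖ ≤ 1 := by simpa using hx
    refine ⟨x, fun u hu hgu => ?_⟩
    have hlift : ∀ n : ℕ, ∃ m : X, Y.mkQ m = u ∧ ‖m‖ < 1 + 1 / ((n : ℝ) + 1) := by
      intro n
      obtain ⟨m, hm, hm2⟩ := Submodule.Quotient.norm_mk_lt (S := Y) u
        (ε := 1 / ((n : ℝ) + 1)) (by positivity)
      exact ⟨m, hm, by rw [hu] at hm2; exact hm2⟩
    choose a ha ha2 using hlift
    have hlim : Filter.Tendsto (fun n : ℕ => 1 + 1 / ((n : ℝ) + 1)) Filter.atTop (nhds 1) := by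
      simpa using tendsto_one_div_add_atTop_nhds_zero_nat.const_add (1 : ℝ)
    have hfa : ∀ n, (g.comp p) (a n) = 1 := by
      intro n
      simp only [ContinuousLinearMap.comp_apply, hp, ha, hgu]
    have hple : ∀ m, ‖p m‖ ≤ ‖m‖ := fun m => Submodule.Quotient.norm_mk_le Y m
    have hfle : ∀ m, (g.comp p) m ≤ ‖m‖ := by
      intro m
      have h1 := g.le_opNorm (p m)
      rw [hg, one_mul] at h1
      exact (le_abs_self _).trans (h1.trans (hple m))
    have hf1 : 1 ≤ ‖g.comp p‖ := by
      have h : Filter.Tendsto (fun n : ℕ => ‖g.comp p‖ * (1 + 1 / ((n : ℝ) + 1)))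
          Filter.atTop (nhds ‖g.comp p‖) := by
        simpa using hlim.const_mul ‖g.comp p‖
      refine ge_of_tendsto' h (fun n => ?_)
      have h1 := (g.comp p).le_opNorm (a n)
      rw [hfa, norm_one] at h1
      exact h1.trans (mul_le_mul_of_nonneg_left (ha2 n).le (norm_nonneg _))
    have hxn : ‖x‖ = 1 := le_antisymm hx1 (by
      have := hfle x
      linarith)
    have h1 : Filter.Tendsto (fun n => ‖a n‖) Filter.atTop (nhds ‖x‖) := by
      rw [hxn]
      refine tendsto_of_tendsto_of_tendsto_of_le_of_le tendsto_const_nhds hlim (fun n => ?_)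
        (fun n => (ha2 n).le)
      have := hfle (a n)
      rw [hfa] at this
      exact this
    have h2 : Filter.Tendsto (fun n => ‖x + a n‖) Filter.atTop (nhds (2 * ‖x‖)) := by
      have h3 := h1.const_add ‖x‖
      rw [← two_mul] at h3
      refine tendsto_of_tendsto_of_tendsto_of_le_of_le tendsto_const_nhds h3 (fun n => ?_)
        (fun n => norm_add_le _ _)
      have := hfle (x + a n)
      rw [map_add, hfa] at this
      show 2 * ‖x‖ ≤ ‖x + a n‖
      linarith
    refine (SeparatingDual.eq_iff_forall_dual_eq (R := ℝ)).2 (fun h => ?_)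
    have h4 := hwlur x a h1 h2 (h.comp p)
    have h5 : (fun n => (h.comp p) (a n)) = fun _ => h u := by
      funext n
      simp only [ContinuousLinearMap.comp_apply, hp, ha]
    rw [h5] at h4
    exact tendsto_nhds_unique tendsto_const_nhds h4
  refine StrictConvexSpace.of_norm_add (fun u v hu hv huv => ?_)
  obtain ⟨g, hg, hguv⟩ := exists_dual_vector ℝ (u + v) (by
    intro h; rw [h] at huv; simp at huv)
  obtain ⟨x, hx⟩ := key g hg
  have hgu := (le_abs_self _).trans (g.le_opNorm u)
  have hgv := (le_abs_self _).trans (g.le_opNorm v)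
  rw [hg, hu] at hgu
  rw [hg, hv] at hgv
  rw [map_add, huv] at hguv
  norm_num at hguv
  rw [hx u hu (by linarith), hx v hv (by linarith)]
  exact SameRay.refl _
end

section
/- Let X be a Banach space whose norm is weakly locally uniformly rotund (WLUR), and let Y ⊆ X be a closed linear subspace of finite codimension. Then Y is proximinal in X if and only if Y⊥ ⊆ NA(X). -/
/-- Let `X` be a Banach space whose norm is WLUR and `Y ⊆ X` a closed linear
subspace of finite codimension.  Then `Y` is proximinal in `X` if and only if `Y⊥ ⊆ NA(X)`. -/
theorem stmt7 {X : Type*} [NormedAddCommGroup X] [NormedSpace ℝ X] [CompleteSpace X]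
    (hwlur : IsWLUR X)
    (Y : Submodule ℝ X) [IsClosed (Y : Set X)] [FiniteDimensional ℝ (X ⧸ Y)] :
    IsProximinal (Y : Set X) ↔
      {f : X →L[ℝ] ℝ | ∀ y ∈ Y, f y = 0} ⊆ NormAttaining X := by
  have hcl : IsClosed (Y : Set X) := inferInstance
  have hne : (Y : Set X).Nonempty := ⟨0, Y.zero_mem⟩
  have hnorm : ∀ x : X, ‖Y.mkQ x‖ = Metric.infDist x (Y : Set X) := fun x =>
    QuotientAddGroup.norm_mk (S := Y.toAddSubgroup) x
  constructor
  · intro hp f hf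
    have hle : Y ≤ LinearMap.ker (f : X →ₗ[ℝ] ℝ) := fun y hy => hf y hy
    set g : X ⧸ Y →ₗ[ℝ] ℝ := Y.liftQ (f : X →ₗ[ℝ] ℝ) hle with hg
    have hgf : ∀ x, g (Y.mkQ x) = f x := fun x => by simp [hg]
    have hgc : Continuous g := g.continuous_of_finiteDimensional
    have : ProperSpace (X ⧸ Y) := FiniteDimensional.proper ℝ _
    obtain ⟨q, hq, hmax⟩ := (isCompact_closedBall (0 : X ⧸ Y) 1).exists_isMaxOn
      ⟨0, by simp⟩ hgc.continuousOn
    obtain ⟨x, rfl⟩ := Y.mkQ_surjective q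
    obtain ⟨y, hy, hxy⟩ := hp x
    have hq1 : ‖x - y‖ ≤ 1 := by
      rw [hxy, ← hnorm]; simpa using hq
    have hb : ∀ v : X, ‖v‖ ≤ 1 → f v ≤ f x := by
      intro v hv
      rw [← hgf, ← hgf]
      apply hmax
      rw [mem_closedBall_zero_iff, hnorm]
      refine le_trans (Metric.infDist_le_dist_of_mem (Y.zero_mem)) ?_
      simpa using hv
    refine ⟨x - y, by simpa using hq1, ?_⟩
    have h0 : f y = 0 := hf y hy
    apply le_antisymm
    · calc f (x - y) ≤ ‖f (x - y)‖ := le_abs_self _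
        _ ≤ ‖f‖ * ‖x - y‖ := f.le_opNorm _
        _ ≤ ‖f‖ * 1 := by gcongr
        _ = ‖f‖ := mul_one _
    · rw [map_sub, h0, sub_zero]
      refine ContinuousLinearMap.opNorm_le_of_unit_norm (by simpa using hb 0 (by simp)) ?_
      intro v hv
      rw [Real.norm_eq_abs, abs_le]
      have h1 := hb v hv.le
      have h2 := hb (-v) (by simpa using hv.le)
      rw [map_neg] at h2
      constructor <;> linarith
  · intro hna x0
    set d := Metric.infDist x0 (Y : Set X) with hd
    have hqle : ∀ v : X, ‖Y.mkQ v‖ ≤ 1 * ‖v‖ := by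
      intro v
      rw [hnorm, one_mul]
      simpa using Metric.infDist_le_dist_of_mem (x := v) (Y.zero_mem)
    let Q : X →L[ℝ] X ⧸ Y := Y.mkQ.mkContinuous 1 hqle
    have hQ : ∀ v, Q v = Y.mkQ v := fun _ => rfl
    rcases (Metric.infDist_nonneg (x := x0) (s := (Y : Set X))).eq_or_lt with h0 | hpos
    · refine ⟨x0, (hcl.mem_iff_infDist_zero hne).2 h0.symm, ?_⟩
      rw [hd, ← h0]; simp
    rw [← hd] at hpos
    have hQ0 : ‖Q x0‖ = d := by rw [hQ, hnorm]
    obtain ⟨g, hg1, hgx⟩ := exists_dual_vector ℝ (Q x0) (by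
      intro h; rw [h] at hQ0; exact hpos.ne hQ0)
    rw [hQ0] at hgx
    have hQY : ∀ y ∈ Y, Q y = 0 := fun y hy => by
      rw [hQ]; simpa using hy
    have hfx0 : (g.comp Q) x0 = d := by simpa using hgx
    obtain ⟨x, hx1, hfx⟩ := hna (show g.comp Q ∈ _ from fun y hy => by simp [hQY y hy])
    have hx1 : ‖x‖ ≤ 1 := by simpa using hx1
    set f := g.comp Q with hf
    have hflt : ∀ v, f v ≤ ‖v‖ := fun v => by
      calc f v ≤ ‖g (Q v)‖ := le_abs_self _
        _ ≤ ‖g‖ * ‖Q v‖ := g.le_opNorm _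
        _ ≤ ‖v‖ := by rw [hg1, one_mul]; exact (hqle v).trans_eq (one_mul _)
    have hex : ∀ n : ℕ, ∃ y ∈ (Y : Set X), dist x0 y < d + 1 / ((n : ℝ) + 1) := fun n =>
      (Metric.infDist_lt_iff hne).1 (by
        have : (0 : ℝ) < 1 / ((n : ℝ) + 1) := by positivity
        linarith)
    choose y hyY hyd using hex
    have hfn : ∀ n, f (x0 - y n) = d := fun n => by
      rw [map_sub, hfx0]; simp [hf, hQY _ (hyY n)]
    have hlim : Filter.Tendsto (fun n => ‖x0 - y n‖) Filter.atTop (nhds d) := by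
      refine tendsto_of_tendsto_of_tendsto_of_le_of_le tendsto_const_nhds
        (h := fun n : ℕ => d + 1 / ((n : ℝ) + 1)) ?_ ?_ ?_
      · simpa using tendsto_const_nhds.add (tendsto_one_div_add_atTop_nhds_zero_nat (𝕜 := ℝ))
      · intro n; have := hflt (x0 - y n); rw [hfn] at this; exact this
      · intro n; have := hyd n; rw [dist_eq_norm] at this; exact this.le
    have hfge : d ≤ ‖f‖ * d := by
      refine le_of_tendsto_of_tendsto' tendsto_const_nhds (hlim.const_mul ‖f‖) fun n => ?_
      calc d = f (x0 - y n) := (hfn n).symm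
        _ ≤ ‖f (x0 - y n)‖ := le_abs_self _
        _ ≤ _ := f.le_opNorm _
    have hf1 : 1 ≤ f x := by rw [hfx]; nlinarith
    have hfx1 : f x = 1 := le_antisymm ((hflt x).trans hx1) hf1
    have hxn : ‖x‖ = 1 := le_antisymm hx1 (hfx1 ▸ hflt x)
    have hz : ‖d • x‖ = d := by rw [norm_smul, hxn, mul_one, Real.norm_of_nonneg hpos.le]
    have key := hwlur (d • x) (fun n => x0 - y n) (by rw [hz]; exact hlim) (by
      rw [hz]
      refine tendsto_of_tendsto_of_tendsto_of_le_of_le tendsto_const_nhds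
        (h := fun n : ℕ => d + ‖x0 - y n‖) ?_ ?_ ?_
      · rw [two_mul]; exact tendsto_const_nhds.add hlim
      · intro n
        have := hflt (d • x + (x0 - y n))
        rw [map_add, hfn, map_smul, hfx1, smul_eq_mul] at this
        show 2 * d ≤ ‖d • x + (x0 - y n)‖
        linarith
      · intro n; exact (norm_add_le _ _).trans_eq (by rw [hz]))
    have hmem : x0 - d • x ∈ Y := by
      have : Q (x0 - d • x) = 0 := by
        refine (NormedSpace.eq_zero_iff_forall_dual_eq_zero ℝ _).2 fun h => ?_
        have h1 := key (h.comp Q)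
        have h2 : (fun n => (h.comp Q) (x0 - y n)) = fun _ => h (Q x0) := by
          funext n; simp [hQY _ (hyY n)]
        rw [h2] at h1
        have := tendsto_nhds_unique h1 tendsto_const_nhds
        rw [map_sub, map_sub]
        simpa [sub_eq_zero] using this.symm
      rw [hQ] at this; exact (Submodule.Quotient.mk_eq_zero Y).1 this
    exact ⟨_, hmem, by rw [sub_sub_cancel, hz]⟩
end

section
/- Let X be a normed linear space and let Y ⊆ Z ⊆ X be linear subspaces such that the codimension of Y in Z is finite. If Y is proximinal in X, then Z is proximinal in X. -/
theorem aux_fd {E : Type*} [NormedAddCommGroup E] [NormedSpace ℝ E] (W : Submodule ℝ E)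
    [FiniteDimensional ℝ W] (x : E) : ∃ w ∈ W, ∀ v ∈ W, ‖x - w‖ ≤ ‖x - v‖ := by
  have : ProperSpace W := FiniteDimensional.proper ℝ W
  have hlim : Filter.Tendsto (fun w : W => ‖x - (w : E)‖)
      (Filter.cocompact W) Filter.atTop := by
    refine Filter.tendsto_atTop_mono (fun w => ?_)
      (Filter.tendsto_atTop_add_const_right _ (-‖x‖) (tendsto_norm_cocompact_atTop (E := W)))
    have := norm_sub_norm_le (w : E) x
    rw [norm_sub_rev] at this
    simpa [sub_eq_add_neg] using this
  have hc : Continuous (fun w : W => ‖x - (w : E)‖) :=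
    (continuous_const.sub continuous_subtype_val).norm
  obtain ⟨w, hw⟩ := hc.exists_forall_le hlim
  exact ⟨w, w.2, fun v hv => hw ⟨v, hv⟩⟩

theorem aux_norm {X : Type*} [NormedAddCommGroup X] [NormedSpace ℝ X] (Y : Submodule ℝ X)
    (x : X) : ‖Y.mkQ x‖ = Metric.infDist x (Y : Set X) :=
  QuotientAddGroup.norm_mk (S := Y.toAddSubgroup) x

theorem aux_range {X : Type*} [AddCommGroup X] [Module ℝ X] (Y Z : Submodule ℝ X)
    [FiniteDimensional ℝ (Z ⧸ Submodule.comap Z.subtype Y)] :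
    FiniteDimensional ℝ (Z.map Y.mkQ) := by
  have h : Z.map Y.mkQ =
      LinearMap.range (Submodule.mapQ (Submodule.comap Z.subtype Y) Y Z.subtype le_rfl) := by
    rw [Submodule.range_mapQ, Submodule.range_subtype]
  rw [h]
  infer_instance

/-- Let `X` be a normed linear space and `Y ⊆ Z ⊆ X` linear subspaces such
that the codimension of `Y` in `Z` is finite.  If `Y` is proximinal in `X`, then so is `Z`. -/
theorem stmt8 {X : Type*} [NormedAddCommGroup X] [NormedSpace ℝ X]
    (Y Z : Submodule ℝ X) (hYZ : Y ≤ Z)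
    [FiniteDimensional ℝ (Z ⧸ Submodule.comap Z.subtype Y)]
    (hY : IsProximinal (Y : Set X)) :
    IsProximinal (Z : Set X) := by
  have hcl : IsClosed (Y : Set X) := by
    refine isClosed_of_closure_subset fun x hx => ?_
    obtain ⟨y, hy, h⟩ := hY x
    rw [Metric.infDist_zero_of_mem_closure hx, norm_eq_zero, sub_eq_zero] at h
    rw [h]; exact hy
  have : IsClosed (Y : Set X) := hcl
  have hle : ∀ x : X, ‖Y.mkQ x‖ ≤ ‖x‖ := fun x => by
    rw [aux_norm]
    simpa using Metric.infDist_le_dist_of_mem (x := x) Y.zero_mem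
  intro x
  have := aux_range Y Z
  obtain ⟨w, hwZ, hw⟩ := aux_fd (Z.map Y.mkQ) (Y.mkQ x)
  obtain ⟨z, hz, rfl⟩ := Submodule.mem_map.1 hwZ
  obtain ⟨y, hy, h⟩ := hY (x - z)
  have hmem : (z : X) + y ∈ (Z : Set X) := Z.add_mem hz (hYZ hy)
  refine ⟨z + y, hmem, le_antisymm ?_ ?_⟩
  · refine (Metric.le_infDist ⟨_, hmem⟩).2 fun z' hz' => ?_
    have h1 := hw (Y.mkQ z') (Submodule.mem_map_of_mem hz')
    rw [← map_sub, ← map_sub] at h1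
    rw [← sub_sub, h, ← aux_norm, dist_eq_norm]
    exact h1.trans (hle _)
  · rw [← dist_eq_norm]
    exact Metric.infDist_le_dist_of_mem hmem
end

section
/- Let X be a normed linear space. If X has no proximinal linear subspace of codimension 2, then X has no proximinal linear subspace of any finite codimension greater than 2. -/
/-- Let `X` be a normed linear space.  If `X` has no proximinal linear
subspace of codimension `2`, then `X` has no proximinal linear subspace of any finite
codimension greater than `2`. -/
theorem stmt9 {X : Type*} [NormedAddCommGroup X] [NormedSpace ℝ X]
    (h2 : ∀ Y : Submodule ℝ X, FiniteDimensional ℝ (X ⧸ Y) →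
      Module.finrank ℝ (X ⧸ Y) = 2 → ¬ IsProximinal (Y : Set X)) :
    ∀ Y : Submodule ℝ X, FiniteDimensional ℝ (X ⧸ Y) →
      2 < Module.finrank ℝ (X ⧸ Y) → ¬ IsProximinal (Y : Set X) := by
  intro Y hfin hY hprox
  have hcl : IsClosed (Y : Set X) := by
    apply isClosed_of_closure_subset
    intro x hx
    obtain ⟨y, hy, hxy⟩ := hprox x
    rw [(Metric.mem_closure_iff_infDist_zero ⟨0, Y.zero_mem⟩).1 hx, norm_eq_zero, sub_eq_zero] at hxy
    rw [hxy]; exact hy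
  haveI : IsClosed (Y : Set X) := hcl
  obtain ⟨f, hf⟩ := exists_linearIndependent_of_le_finrank (R := ℝ) (M := X ⧸ Y)
    (n := Module.finrank ℝ (X ⧸ Y) - 2) (Nat.sub_le _ _)
  have hT := finrank_span_eq_card hf
  generalize Submodule.span ℝ (Set.range f) = T at hT
  rw [Fintype.card_fin] at hT
  have hQ := Submodule.finrank_quotient_add_finrank T
  let g : X →ₗ[ℝ] ((X ⧸ Y) ⧸ T) := T.mkQ ∘ₗ Y.mkQ
  have hg : Function.Surjective g := T.mkQ_surjective.comp Y.mkQ_surjective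
  let e := g.quotKerEquivOfSurjective hg
  have hmem : ∀ x, x ∈ LinearMap.ker g ↔ Y.mkQ x ∈ T := by
    intro x; simp [g, LinearMap.mem_ker]
  refine h2 (LinearMap.ker g) (e.symm.finiteDimensional) (by rw [e.finrank_eq]; omega) ?_
  intro x
  haveI : ProperSpace (X ⧸ Y) := FiniteDimensional.proper ℝ (X ⧸ Y)
  obtain ⟨q, hq, hqd⟩ := T.closed_of_finiteDimensional.exists_infDist_eq_dist ⟨0, T.zero_mem⟩ (Y.mkQ x)
  obtain ⟨z, rfl⟩ := Y.mkQ_surjective q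
  obtain ⟨y, hy, hyd⟩ := hprox (x - z)
  have hn : ‖Y.mkQ (x - z)‖ = Metric.infDist (x - z) Y :=
    QuotientAddGroup.norm_mk (S := Y.toAddSubgroup) (x - z)
  have hzy : z + y ∈ LinearMap.ker g := by
    rw [hmem, map_add, (by simpa using hy : Y.mkQ y = 0), add_zero]; exact hq
  refine ⟨z + y, hzy, le_antisymm ?_ ?_⟩
  · rw [← sub_sub, hyd, ← hn, map_sub, ← dist_eq_norm, ← hqd]
    refine (Metric.le_infDist ⟨0, (LinearMap.ker g).zero_mem⟩).2 fun w hw => ?_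
    refine (Metric.infDist_le_dist_of_mem ((hmem w).1 hw)).trans ?_
    rw [dist_eq_norm, dist_eq_norm, ← map_sub]
    exact Submodule.Quotient.norm_mk_le Y (x - w)
  · rw [← dist_eq_norm]
    exact Metric.infDist_le_dist_of_mem hzy
end

section
/- Let A ⊆ ℝ^d be a bounded set. Then the σ-convex hull of A equals the convex hull of A: sconv(A) = conv(A). -/
/-- The σ-convex hull of a set `A` in a normed space: all sums `Σᵢ λᵢ xᵢ` of norm-convergent
series with `λᵢ ∈ [0,1]`, `Σᵢ λᵢ = 1` and `xᵢ ∈ A`. -/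
def sigmaConvexHull {E : Type*} [NormedAddCommGroup E] [NormedSpace ℝ E] (A : Set E) :
    Set E :=
  {y | ∃ (l : ℕ → ℝ) (x : ℕ → E),
    (∀ i, l i ∈ Set.Icc (0 : ℝ) 1) ∧ HasSum l 1 ∧ (∀ i, x i ∈ A) ∧
    HasSum (fun i => l i • x i) y}

open scoped NNReal in
theorem cone_aux {E : Type*} [NormedAddCommGroup E] [NormedSpace ℝ E] [FiniteDimensional ℝ E]
    (x : ℕ → E) (y : E) (h : HasSum x y) (ht : Submodule.span ℝ (Set.range x) = ⊤) :
    y ∈ Submodule.span ℝ≥0 (Set.range x) := by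
  by_contra hy
  set C : Submodule ℝ≥0 E := Submodule.span ℝ≥0 (Set.range x) with hC
  have hsm : ∀ (a : ℝ) (_ : 0 ≤ a) (z : E), z ∈ C → a • z ∈ C := by
    intro a ha z hz
    exact C.smul_mem (⟨a, ha⟩ : ℝ≥0) hz
  have hx : ∀ i, x i ∈ C := fun i => Submodule.subset_span ⟨i, rfl⟩
  have hconv : Convex ℝ (C : Set E) := by
    intro u hu v hv a b ha hb _
    exact C.add_mem (hsm a ha u hu) (hsm b hb v hv)
  have hne : (C : Set E).Nonempty := ⟨0, C.zero_mem⟩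
  have hint : (interior (C : Set E)).Nonempty := by
    rw [hconv.interior_nonempty_iff_affineSpan_eq_top,
      AffineSubspace.affineSpan_eq_top_iff_vectorSpan_eq_top_of_nonempty _ _ _ hne, eq_top_iff, ← ht,
      Submodule.span_le]
    rintro _ ⟨i, rfl⟩
    have := vsub_mem_vectorSpan ℝ (show x i ∈ (C : Set E) from hx i) (show (0:E) ∈ (C : Set E) from C.zero_mem)
    simpa using this
  obtain ⟨f, hf0, hf⟩ := geometric_hahn_banach_of_nonempty_interior_point hconv
    (fun hh => hy (interior_subset hh)) hint
  have hle : ∀ z ∈ C, f z ≤ f y := hf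
  have h0 : 0 ≤ f y := by simpa using hle 0 C.zero_mem
  have hxi : ∀ i, f (x i) ≤ 0 := by
    intro i
    by_contra hp
    push Not at hp
    have := hle _ (hsm ((f y + 1) / f (x i)) (by positivity) _ (hx i))
    rw [map_smul, smul_eq_mul, div_mul_cancel₀ _ hp.ne'] at this
    linarith
  have hs : HasSum (fun i => - f (x i)) (- f y) := (f.hasSum h).neg
  have hz : ∀ i, f (x i) = 0 := by
    intro i
    have := le_hasSum hs i (fun j _ => by linarith [hxi j])
    linarith [hxi i]
  apply hf0
  have : Submodule.span ℝ (Set.range x) ≤ LinearMap.ker (f : E →ₗ[ℝ] ℝ) := by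
    rw [Submodule.span_le]
    rintro _ ⟨i, rfl⟩
    exact hz i
  rw [ht] at this
  ext z
  exact this (Submodule.mem_top (x := z))

open scoped NNReal in
theorem cone_aux2 {E : Type*} [NormedAddCommGroup E] [NormedSpace ℝ E] [FiniteDimensional ℝ E]
    (x : ℕ → E) (y : E) (h : HasSum x y) :
    ∃ c : ℕ →₀ ℝ≥0, c.sum (fun i a => (a : ℝ) • x i) = y := by
  set W := Submodule.span ℝ (Set.range x) with hW
  have hx : ∀ i, x i ∈ W := fun i => Submodule.subset_span ⟨i, rfl⟩
  have hy : y ∈ W := W.closed_of_finiteDimensional.mem_of_tendsto h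
    (Filter.Eventually.of_forall fun s => W.sum_mem fun i _ => hx i)
  have h' : HasSum (fun i => (⟨x i, hx i⟩ : W)) ⟨y, hy⟩ := by
    rw [← Topology.IsInducing.subtypeVal.hasSum_iff (g := W.subtype)]
    exact h
  have ht : Submodule.span ℝ (Set.range (fun i => (⟨x i, hx i⟩ : W))) = ⊤ := by
    apply Submodule.map_injective_of_injective W.injective_subtype
    rw [Submodule.map_span, ← Set.range_comp, Submodule.map_top, Submodule.range_subtype]
    rfl
  have := cone_aux _ _ h' ht
  rw [Finsupp.mem_span_range_iff_exists_finsupp] at this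
  obtain ⟨c, hc⟩ := this
  refine ⟨c, ?_⟩
  have h2 := congrArg W.subtype hc
  rw [Finsupp.sum, map_sum] at h2
  exact h2

theorem hull_aux {E : Type*} [NormedAddCommGroup E] [NormedSpace ℝ E] [FiniteDimensional ℝ E]
    (A : Set E) (l : ℕ → ℝ) (x : ℕ → E) (y : E) (hl : ∀ i, 0 ≤ l i) (hl1 : HasSum l 1)
    (hx : ∀ i, x i ∈ A) (hy : HasSum (fun i => l i • x i) y) : y ∈ convexHull ℝ A := by
  have hp : HasSum (fun i => (l i, l i • x i)) ((1 : ℝ), y) := hl1.prodMk hy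
  obtain ⟨c, hc⟩ := cone_aux2 (E := ℝ × E) (fun i => (l i, l i • x i)) (1, y) hp
  have h1 := congrArg Prod.fst hc
  have h2 := congrArg Prod.snd hc
  simp only [Finsupp.sum, Prod.fst_sum, Prod.snd_sum, Prod.smul_fst, Prod.smul_snd,
    smul_eq_mul, smul_smul] at h1 h2
  rw [← h2]
  exact (convex_convexHull ℝ A).sum_mem
    (fun i _ => mul_nonneg (c i).2 (hl i)) h1 (fun i _ => subset_convexHull ℝ A (hx i))

/-- For a bounded set `A ⊆ ℝ^d`, the σ-convex hull of `A` equals the convex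
hull of `A`. -/
theorem stmt11 {d : ℕ} (A : Set (EuclideanSpace ℝ (Fin d)))
    (hA : Bornology.IsBounded A) :
    sigmaConvexHull A = convexHull ℝ A := by
  apply Set.Subset.antisymm
  · rintro y ⟨l, x, hl, hl1, hx, hy⟩
    exact hull_aux A l x y (fun i => (hl i).1) hl1 hx hy
  · intro y hy
    obtain ⟨a, ha⟩ : A.Nonempty := convexHull_nonempty_iff.1 ⟨y, hy⟩
    rw [convexHull_eq] at hy
    obtain ⟨ι, t, w, z, hw, hw1, hz, rfl⟩ := hy
    let e := t.equivFin
    have hle : ∀ i ∈ t, w i ≤ 1 := fun i hi => hw1 ▸ Finset.single_le_sum hw hi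
    let l : ℕ → ℝ := fun n => if h : n < t.card then w (e.symm ⟨n, h⟩) else 0
    let x : ℕ → EuclideanSpace ℝ (Fin d) :=
      fun n => if h : n < t.card then z (e.symm ⟨n, h⟩) else a
    have hl1 : ∑ n ∈ Finset.range t.card, l n = 1 := by
      rw [Finset.sum_range, ← hw1, ← Finset.sum_coe_sort t, ← e.symm.sum_comp]
      simp [l]
    have hly : ∑ n ∈ Finset.range t.card, l n • x n = t.centerMass w z := by
      rw [Finset.centerMass_eq_of_sum_1 _ _ hw1, Finset.sum_range,
        ← Finset.sum_coe_sort t, ← e.symm.sum_comp]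
      simp [l, x]
    have hl0 : ∀ n ∉ Finset.range t.card, l n = 0 := by
      intro n hn
      simp only [Finset.mem_range] at hn
      simp [l, hn]
    refine ⟨l, x, ?_, ?_, ?_, ?_⟩
    · intro n
      by_cases h : n < t.card
      · simp only [l, h, dif_pos]
        exact ⟨hw _ (e.symm ⟨n, h⟩).2, hle _ (e.symm ⟨n, h⟩).2⟩
      · simp [l, h]
    · rw [← hl1]
      exact hasSum_sum_of_ne_finset_zero hl0
    · intro n
      by_cases h : n < t.card
      · simp only [x, h, dif_pos]
        exact hz _ (e.symm ⟨n, h⟩).2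
      · simpa [x, h] using ha
    · rw [← hly]
      exact hasSum_sum_of_ne_finset_zero (fun n hn => by rw [hl0 n hn, zero_smul])
end

section
/- Let X be a non-reflexive Banach space, d ∈ ℕ, Y ⊆ X a closed subspace of codimension d in X, and q : X → X/Y the quotient map. Let ‖·‖ be an equivalent norm on X/Y and let A ⊆ X/Y be a symmetric (A = −A) convex F_σ set satisfying U_{(X/Y,‖·‖)} ⊆ A ⊆ B_{(X/Y,‖·‖)}, and suppose there exist v ∈ ∂A and r ∈ (0,1) such that A ∖ (U_{‖·‖}(v,r) ∪ U_{‖·‖}(−v,r)) is closed. Then X admits an equivalent norm |‖·‖| such that q maps the closed unit ball of (X, |‖·‖|) exactly onto A, i.e. q(B_{(X,|‖·‖|)}) = A. -/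
/-- `N` is a norm on `X` equivalent to the given norm `‖·‖`: it is subadditive, absolutely
homogeneous, and bounded above and below by positive multiples of `‖·‖`. -/
def IsEquivNorm {X : Type*} [SeminormedAddCommGroup X] [NormedSpace ℝ X] (N : X → ℝ) : Prop :=
  (∀ x y : X, N (x + y) ≤ N x + N y) ∧
  (∀ (c : ℝ) (x : X), N (c • x) = |c| * N x) ∧
  ∃ c C : ℝ, 0 < c ∧ ∀ x : X, c * ‖x‖ ≤ N x ∧ N x ≤ C * ‖x‖


section Aux
open Set Filter Topology

theorem aux_compact_hull {E : Type*} [NormedAddCommGroup E] [NormedSpace ℝ E]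
    [FiniteDimensional ℝ E] {K : Set E} (hK : IsCompact K) : IsCompact (convexHull ℝ K) := by
  classical
  rcases K.eq_empty_or_nonempty with rfl | ⟨x0, hx0⟩
  · simp
  set n := Module.finrank ℝ E + 1
  let Φ : (Fin n → ℝ) × (Fin n → E) → E := fun p => ∑ i, p.1 i • p.2 i
  have hΦ : Continuous Φ := by fun_prop
  have hc : IsCompact ((stdSimplex ℝ (Fin n)) ×ˢ (Set.univ.pi fun _ : Fin n => K)) :=
    (isCompact_stdSimplex ℝ (Fin n)).prod (isCompact_univ_pi fun _ => hK)
  have : convexHull ℝ K = Φ '' ((stdSimplex ℝ (Fin n)) ×ˢ (Set.univ.pi fun _ : Fin n => K)) := by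
    apply Subset.antisymm
    · intro x hx
      obtain ⟨ι, _, z, w, hz, hind, hw, hw1, hwx⟩ := eq_pos_convex_span_of_mem_convexHull hx
      have hcard : Fintype.card ι ≤ Fintype.card (Fin n) := by
        simpa [n] using hind.card_le_finrank_succ.trans
          (Nat.succ_le_succ (Submodule.finrank_le _))
      obtain ⟨e⟩ := Function.Embedding.nonempty_of_card_le hcard
      have hw0 : ∀ i ∉ Set.range e, Function.extend e w 0 i = 0 := by
        intro i hi
        rw [Function.extend_apply' _ _ _ (by simpa using hi)]; rfl
      refine ⟨(Function.extend e w 0, Function.extend e z (fun _ => x0)), ⟨⟨?_, ?_⟩, ?_⟩, ?_⟩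
      · intro i
        by_cases hi : i ∈ Set.range e
        · obtain ⟨j, rfl⟩ := hi
          simpa [e.injective.extend_apply] using (hw j).le
        · simp [hw0 i hi]
      · rw [← hw1]
        symm
        apply Fintype.sum_of_injective e e.injective _ _ hw0
        intro i; simp [e.injective.extend_apply]
      · intro i _
        by_cases hi : i ∈ Set.range e
        · obtain ⟨j, rfl⟩ := hi
          simpa [e.injective.extend_apply] using hz ⟨j, rfl⟩
        · show Function.extend e z (fun _ => x0) i ∈ K
          rw [Function.extend_apply' _ _ _ (by simpa using hi)]; exact hx0
      · rw [← hwx]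
        symm
        apply Fintype.sum_of_injective e e.injective
        · intro i hi; simp [hw0 i hi]
        · intro i; simp [e.injective.extend_apply]
    · rintro _ ⟨⟨w, z⟩, ⟨⟨hw, hw1⟩, hz⟩, rfl⟩
      exact (convex_convexHull ℝ K).sum_mem (fun i _ => hw i) hw1
        (fun i _ => subset_convexHull ℝ K (hz i trivial))
  rw [this]
  exact hc.image hΦ

theorem aux_sigma_convex {E : Type*} [NormedAddCommGroup E] [NormedSpace ℝ E]
    [FiniteDimensional ℝ E] {A : Set E} (hA : Convex ℝ A) {w : ℕ → ℝ} {p : ℕ → E} {z : E}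
    (hw : ∀ i, 0 ≤ w i) (hw1 : HasSum w 1) (hp : ∀ i, p i ∈ A)
    (hz : HasSum (fun i => w i • p i) z) : z ∈ A := by
  classical
  -- the set of differences with positive weight
  set I : Set E := (fun i => p i - z) '' {i | 0 < w i} with hI
  let V : Submodule ℝ E := Submodule.span ℝ I
  have hmem : ∀ i, 0 < w i → p i - z ∈ V := fun i hi => Submodule.subset_span ⟨i, hi, rfl⟩
  let c : ℕ → V := fun i => if h : 0 < w i then ⟨p i - z, hmem i h⟩ else 0
  have hc : ∀ i, w i • (c i : E) = w i • p i - w i • z := by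
    intro i
    by_cases h : 0 < w i
    · simp [c, h, smul_sub]
    · have : w i = 0 := le_antisymm (not_lt.1 h) (hw i)
      simp [this]
  have hsum : HasSum (fun i => w i • (c i : E)) 0 := by
    simp only [hc]
    simpa using hz.sub (hw1.smul_const z)
  let C : Set V := convexHull ℝ (c '' {i | 0 < w i})
  have hlin : ∀ f : StrongDual ℝ V, HasSum (fun i => w i * f (c i)) 0 := by
    intro f
    obtain ⟨g, hg, -⟩ := exists_extension_norm_eq V f
    have := g.hasSum hsum
    simpa [hg] using this
  have hCspan : Submodule.span ℝ (c '' {i | 0 < w i}) = ⊤ := by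
    rw [eq_top_iff]
    have key : V ≤ (Submodule.span ℝ (c '' {i | 0 < w i})).map V.subtype := by
      apply Submodule.span_le.2
      rintro _ ⟨i, hi, rfl⟩
      refine ⟨c i, Submodule.subset_span ⟨i, hi, rfl⟩, ?_⟩
      have hi' : 0 < w i := hi
      simp [c, hi']
    rintro ⟨x, hx⟩ -
    obtain ⟨y, hy, hyx⟩ := key hx
    have : y = ⟨x, hx⟩ := Subtype.ext hyx
    exact this ▸ hy
  have hex : ∃ i, 0 < w i := by
    by_contra! h
    have : w = 0 := funext fun i => le_antisymm (h i) (hw i)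
    rw [this] at hw1
    exact zero_ne_one (hasSum_zero.unique hw1)
  have h0 : (0 : V) ∈ C := by
    by_contra h0
    -- f ≤ 0 on C, then zero on all c i
    have hfin : ∀ f : StrongDual ℝ V, (∀ i, 0 < w i → f (c i) ≤ 0) → f = 0 := by
      intro f hf
      have h1 : ∀ i, w i * f (c i) ≤ 0 := by
        intro i
        by_cases h : 0 < w i
        · exact mul_nonpos_of_nonneg_of_nonpos (hw i) (hf i h)
        · simp [le_antisymm (not_lt.1 h) (hw i)]
      have h2 : ∀ i, w i * f (c i) = 0 := by
        have h3 := (hasSum_zero_iff_of_nonneg (f := fun i => -(w i * f (c i)))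
          (fun i => by simpa using h1 i)).1 (by simpa using (hlin f).neg)
        intro i
        have := congrFun h3 i
        simpa using this
      have h4 : (f : V →ₗ[ℝ] ℝ) = 0 := by
        apply LinearMap.ext_on hCspan
        rintro _ ⟨i, hi, rfl⟩
        have hi' : 0 < w i := hi
        have := h2 i
        simpa [hi'.ne'] using this
      ext x
      exact congrArg (fun g : V →ₗ[ℝ] ℝ => g x) h4
    have hint : (interior C).Nonempty := by
      rw [interior_convexHull_nonempty_iff_affineSpan_eq_top]
      by_contra hne
      -- separate: affine span is a closed proper subset
      obtain ⟨i0, hi0⟩ := hex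
      have hdir : (affineSpan ℝ (c '' {i | 0 < w i})).direction ≠ ⊤ := by
        intro h
        apply hne
        rw [← AffineSubspace.direction_eq_top_iff_of_nonempty]
        · exact h
        · exact ⟨c i0, subset_affineSpan ℝ _ ⟨i0, hi0, rfl⟩⟩
      obtain ⟨f, hf, hf0⟩ := Submodule.exists_le_ker_of_lt_top _ (lt_top_iff_ne_top.2 hdir)
      have hconst : ∀ i, 0 < w i → f (c i) = f (c i0) := by
        intro i hi
        have : c i -ᵥ c i0 ∈ (affineSpan ℝ (c '' {i | 0 < w i})).direction :=
          AffineSubspace.vsub_mem_direction (subset_affineSpan ℝ _ ⟨i, hi, rfl⟩)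
            (subset_affineSpan ℝ _ ⟨i0, hi0, rfl⟩)
        have := hf0 this
        simpa [sub_eq_zero] using this
      let g : StrongDual ℝ V := LinearMap.toContinuousLinearMap f
      have hg : ∀ x, g x = f x := fun x => rfl
      rcases le_total (f (c i0)) 0 with h | h
      · have := hfin g (fun i hi => by rw [hg, hconst i hi]; exact h)
        apply hf; ext x; rw [← hg, this]; rfl
      · have := hfin (-g) (fun i hi => by
          rw [neg_apply, hg, hconst i hi]; linarith)
        apply hf; ext x; rw [← hg, neg_eq_zero.1 this]; rfl
    have hCc : Convex ℝ C := convex_convexHull ℝ _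
    obtain ⟨f, hf⟩ := geometric_hahn_banach_open_point hCc.interior isOpen_interior
      (fun h => h0 (interior_subset h))
    have hle : ∀ x ∈ C, f x ≤ 0 := by
      intro x hx
      have hx' : x ∈ closure (interior C) := by
        rw [hCc.closure_interior_eq_closure_of_nonempty_interior hint]
        exact subset_closure hx
      have hsub : closure (interior C) ⊆ {x | f x ≤ 0} :=
        closure_minimal (fun y hy => by simpa using (hf y hy).le)
          (isClosed_le f.continuous continuous_const)
      exact hsub hx'
    have hf0 := hfin f (fun i hi => hle _ (subset_convexHull ℝ _ ⟨i, hi, rfl⟩))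
    obtain ⟨x, hx⟩ := hint
    have := hf x hx
    simp [hf0] at this
  -- transport back
  have hmap : ∀ x ∈ C, (x : E) + z ∈ A := by
    have hcv : Convex ℝ {x : V | (x : E) + z ∈ A} := by
      intro x hx y hy a b ha hb hab
      have := hA hx hy ha hb hab
      simp only [Set.mem_ofPred_eq] at *
      convert! this using 1
      have : z = (a + b) • z := by rw [hab, one_smul]
      nth_rewrite 1 [this]
      simp only [Submodule.coe_add, Submodule.coe_smul]
      module
    apply convexHull_min _ hcv
    rintro _ ⟨i, hi, rfl⟩
    have hi' : 0 < w i := hi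
    simpa [c, hi'] using hp i
  simpa using hmap 0 h0

theorem aux_fd_reflexive {E : Type*} [NormedAddCommGroup E] [NormedSpace ℝ E]
    [FiniteDimensional ℝ E] (ξ : StrongDual ℝ (StrongDual ℝ E)) :
    ∃ x : E, ∀ f : StrongDual ℝ E, ξ f = f x := by
  let L : Module.Dual ℝ (Module.Dual ℝ E) :=
    (ξ : StrongDual ℝ E →ₗ[ℝ] ℝ) ∘ₗ (LinearMap.toContinuousLinearMap (𝕜 := ℝ) (E := E) (F' := ℝ)).toLinearMap
  refine ⟨(Module.evalEquiv ℝ E).symm L, fun f => ?_⟩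
  have h := Module.apply_evalEquiv_symm_apply ℝ E (f : E →ₗ[ℝ] ℝ) L
  have h2 : L (f : E →ₗ[ℝ] ℝ) = ξ f := by
    simp [L]; congr 1
  rw [← h2, ← h]; rfl

theorem aux_helly {Y : Type*} [NormedAddCommGroup Y] [NormedSpace ℝ Y]
    (ξ : StrongDual ℝ (StrongDual ℝ Y)) (s : Finset (StrongDual ℝ Y)) :
    ∃ x : Y, ‖x‖ ≤ ‖ξ‖ + 1 ∧ ∀ f ∈ s, f x = ξ f := by
  let L : Y →L[ℝ] (s → ℝ) := ContinuousLinearMap.pi fun f => (f : StrongDual ℝ Y)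
  let W : Submodule ℝ Y := LinearMap.ker (L : Y →ₗ[ℝ] (s → ℝ))
  have hWc : IsClosed (W : Set Y) := L.isClosed_ker
  have : FiniteDimensional ℝ (Y ⧸ W) :=
    ((L : Y →ₗ[ℝ] (s → ℝ)).quotKerEquivRange).symm.finiteDimensional
  let q : Y →L[ℝ] (Y ⧸ W) := W.mkQL
  have hq1 : ∀ y, ‖q y‖ ≤ ‖y‖ := fun y => Submodule.Quotient.norm_mk_le W y
  let qd : StrongDual ℝ (Y ⧸ W) →L[ℝ] StrongDual ℝ Y := (ContinuousLinearMap.compL ℝ Y (Y ⧸ W) ℝ).flip q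
  have hqd : ∀ h y, qd h y = h (q y) := fun h y => rfl
  obtain ⟨p, hp⟩ := aux_fd_reflexive (ξ.comp qd)
  have hpn : ‖p‖ ≤ ‖ξ‖ := by
    apply NormedSpace.norm_le_dual_bound ℝ p (M := ‖ξ‖) (norm_nonneg ξ)
    intro f
    rw [← hp f]
    refine (ξ.le_opNorm (qd f)).trans ?_
    gcongr
    apply ContinuousLinearMap.opNorm_le_bound _ (norm_nonneg f)
    intro y
    rw [hqd]
    exact (f.le_opNorm _).trans (by gcongr; exact hq1 y)
  obtain ⟨x, hx, hxn⟩ := Submodule.Quotient.norm_mk_lt p (ε := 1) one_pos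
  refine ⟨x, by linarith, fun f hf => ?_⟩
  have hker : W ≤ LinearMap.ker (f : Y →ₗ[ℝ] ℝ) := by
    intro y hy
    have : L y = 0 := hy
    have := congrFun this ⟨f, hf⟩
    simpa [L] using this
  let h : StrongDual ℝ (Y ⧸ W) := LinearMap.toContinuousLinearMap (W.liftQ (f : Y →ₗ[ℝ] ℝ) hker)
  have hh : qd h = f := by
    ext y; rfl
  have := hp h
  rw [ContinuousLinearMap.comp_apply, hh] at this
  rw [this, ← hx]; rfl

theorem aux_big {E : Type*} [NormedAddCommGroup E] [NormedSpace ℝ E]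
    (ζ : StrongDual ℝ E) {δ : ℝ} (hδ : 0 < δ) (h1 : δ ≤ ‖ζ‖) : ∃ f : E, δ / 2 * ‖f‖ < ‖ζ f‖ := by
  by_contra! h
  have := ContinuousLinearMap.opNorm_le_bound ζ (M := δ / 2) (by positivity) h
  linarith

theorem aux_annih {Y : Type*} [NormedAddCommGroup Y] [NormedSpace ℝ Y]
    (ξ : StrongDual ℝ (StrongDual ℝ Y)) (δ : ℝ) (hδ : 0 < δ)
    (hξ : ∀ x, δ ≤ ‖ξ - NormedSpace.inclusionInDoubleDual ℝ Y x‖) (s : Finset Y) :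
    ∃ f : StrongDual ℝ Y, ‖f‖ ≤ 2 / δ ∧ ξ f = 1 ∧ ∀ x ∈ s, f x = 0 := by
  let J := NormedSpace.inclusionInDoubleDual ℝ Y
  let L : s → (StrongDual ℝ Y →ₗ[ℝ] ℝ) := fun x => (J x : StrongDual ℝ Y →ₗ[ℝ] ℝ)
  let W : Submodule ℝ (StrongDual ℝ Y) := ⨅ x, LinearMap.ker (L x)
  have hW : ∀ f ∈ W, ∀ x ∈ s, f x = 0 := by
    intro f hf x hx
    have := (Submodule.mem_iInf _).1 hf ⟨x, hx⟩
    simpa [L, J] using this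
  obtain ⟨ξ', hξ', hnorm⟩ := exists_extension_norm_eq W (ξ.comp W.subtypeL)
  have hspan : ((ξ - ξ' : StrongDual ℝ (StrongDual ℝ Y)) : StrongDual ℝ Y →ₗ[ℝ] ℝ) ∈
      Submodule.span ℝ (Set.range L) := by
    apply mem_span_of_iInf_ker_le_ker
    intro f hf
    have := hξ' ⟨f, hf⟩
    simp at this
    simp [this]
  have hx : ∃ x : Y, ξ - ξ' = J x := by
    have hle : Submodule.span ℝ (Set.range L) ≤ LinearMap.range
        ((ContinuousLinearMap.coeLM ℝ : StrongDual ℝ (StrongDual ℝ Y) →ₗ[ℝ] _) ∘ₗ (J : Y →ₗ[ℝ] _)) := by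
      apply Submodule.span_le.2
      rintro _ ⟨x, rfl⟩
      exact ⟨x, rfl⟩
    obtain ⟨x, hx⟩ := hle hspan
    exact ⟨x, (ContinuousLinearMap.coe_injective hx).symm⟩
  obtain ⟨x, hx⟩ := hx
  have h1 : δ ≤ ‖ξ'‖ := by
    have := hξ x
    have h2 : ξ - J x = ξ' := by rw [← hx]; abel
    rwa [h2] at this
  rw [hnorm] at h1
  have : ∃ f : W, δ / 2 * ‖f‖ < ‖(ξ.comp W.subtypeL) f‖ := by
    exact aux_big (E := W) _ hδ h1
  obtain ⟨f, hf⟩ := this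
  have hf' : δ / 2 * ‖(f : StrongDual ℝ Y)‖ < |ξ f| := by simpa using hf
  have hne : ξ f ≠ 0 := by
    intro h
    rw [h, abs_zero] at hf'
    have : 0 ≤ δ / 2 * ‖(f : StrongDual ℝ Y)‖ := by positivity
    linarith
  refine ⟨(ξ f)⁻¹ • (f : StrongDual ℝ Y), ?_, ?_, ?_⟩
  · rw [norm_smul, norm_inv, Real.norm_eq_abs, inv_mul_le_iff₀ (abs_pos.2 hne), mul_div_assoc', le_div_iff₀ hδ]
    linarith
  · simp [hne]
  · intro x hx
    simp [hW f f.2 x hx]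

theorem aux_james {Y : Type*} [NormedAddCommGroup Y] [NormedSpace ℝ Y] [CompleteSpace Y]
    (hY : ¬ Function.Surjective (NormedSpace.inclusionInDoubleDual ℝ Y)) :
    ∃ (C : ℝ) (x : ℕ → Y) (g : ℕ → StrongDual ℝ Y), 0 < C ∧ (∀ n, ‖x n‖ ≤ C) ∧ (∀ n, ‖g n‖ ≤ C) ∧
      ∀ j n, g j (x n) = if j ≤ n then 1 else 0 := by
  classical
  obtain ⟨ξ, hξ⟩ := not_forall.1 hY
  let J := NormedSpace.inclusionInDoubleDualLi ℝ (E := Y)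
  have hcl : IsClosed (Set.range J) := by
    have h := J.isometry.isUniformInducing.isComplete_range
    exact h.isClosed
  have hnot : ξ ∈ (Set.range J)ᶜ := hξ
  obtain ⟨δ, hδ, hball⟩ := Metric.isOpen_iff.1 hcl.isOpen_compl ξ hnot
  have hd : ∀ x, δ ≤ ‖ξ - NormedSpace.inclusionInDoubleDual ℝ Y x‖ := by
    intro x
    by_contra! h
    have : J x ∈ Metric.ball ξ δ := by
      rw [Metric.mem_ball, dist_comm]; exact (dist_eq_norm ξ (J x)).trans_lt h
    exact hball this ⟨x, rfl⟩
  obtain ⟨F, hF1, hF2⟩ := exists_seq_of_forall_finset_exists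
    (fun p : StrongDual ℝ Y × Y => ξ p.1 = 1 ∧ ‖p.1‖ ≤ 2 / δ ∧ ‖p.2‖ ≤ ‖ξ‖ + 1 ∧ p.1 p.2 = 1)
    (fun p p' => p'.1 p.2 = 0 ∧ p.1 p'.2 = 1) (by
      intro s hs
      obtain ⟨f, hf1, hf2, hf3⟩ := aux_annih ξ δ hδ hd (s.image Prod.snd)
      obtain ⟨x, hx1, hx2⟩ := aux_helly ξ (insert f (s.image Prod.fst))
      refine ⟨(f, x), ⟨hf2, hf1, hx1, ?_⟩, fun p hp => ⟨?_, ?_⟩⟩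
      · exact (hx2 f (by simp)).trans hf2
      · exact hf3 _ (Finset.mem_image_of_mem _ hp)
      · exact (hx2 p.1 (Finset.mem_insert_of_mem (Finset.mem_image_of_mem _ hp))).trans (hs p hp).1)
  have h2 : 0 < 2 / δ := by positivity
  refine ⟨2 / δ + (‖ξ‖ + 1), fun n => (F n).2, fun n => (F n).1, by positivity,
    fun n => ?_, fun n => ?_, fun j n => ?_⟩
  · have := (hF1 n).2.2.1; simp only; linarith
  · have := (hF1 n).2.1
    have := norm_nonneg ξ
    simp only; linarith
  · split_ifs with h
    · rcases h.eq_or_lt with rfl | h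
      · exact (hF1 j).2.2.2
      · exact (hF2 j n h).2
    · exact (hF2 n j (not_le.1 h)).1

/-- The convex set whose closure is the new unit ball. -/
def auxS {X Z : Type*} [NormedAddCommGroup X] [NormedSpace ℝ X] [NormedAddCommGroup Z]
    [NormedSpace ℝ Z] (T : ℕ → Z →L[ℝ] X) (K : ℕ → Set Z) (η : ℝ) : Set X :=
  {x | ∃ (μ : ℕ → ℝ) (k : ℕ → Z) (n : ℕ) (γ : ℝ) (u : X), (∀ i, 0 ≤ μ i) ∧ (∀ i, k i ∈ K i) ∧
    (∀ i, n ≤ i → μ i = 0) ∧ 0 ≤ γ ∧ ∑ i ∈ Finset.range n, μ i + γ ≤ 1 ∧ ‖u‖ ≤ γ * η ∧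
    x = ∑ i ∈ Finset.range n, μ i • T i (k i) + u}

theorem aux_split {E : Type*} [AddCommGroup E] (b : ℕ → E) (n J : ℕ) (hb : ∀ i, n ≤ i → b i = 0) :
    ∑ i ∈ Finset.range n, b i =
      ∑ i ∈ Finset.range J, b i + ∑ i ∈ Finset.Ico J (max n J), b i := by
  rw [Finset.range_eq_Ico, Finset.range_eq_Ico, Finset.sum_Ico_consecutive _ (Nat.zero_le _)
    (le_max_right _ _), ← Finset.sum_Ico_consecutive _ (Nat.zero_le n) (le_max_left n J)]
  rw [Finset.sum_eq_zero (s := Finset.Ico n (max n J))]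
  · simp
  · intro i hi
    exact hb i (Finset.mem_Ico.1 hi).1

theorem aux_level {X Z : Type*} [NormedAddCommGroup X] [NormedSpace ℝ X] [NormedAddCommGroup Z]
    [NormedSpace ℝ Z] (q : X →L[ℝ] Z) (s : Z →L[ℝ] X) (x : ℕ → X) (f : ℕ → StrongDual ℝ X)
    (φ : StrongDual ℝ Z) (p : Seminorm ℝ Z) (K : ℕ → Set Z) (η D : ℝ) (hη : 0 ≤ η)
    (hqs : ∀ z, q (s z) = z) (hqx : ∀ n, q (x n) = 0) (hfs : ∀ n z, f n (s z) = 0)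
    (hfx : ∀ j n, f j (x n) = if j ≤ n then 1 else 0)
    (hK : ∀ i, ∀ k ∈ K i, p k ≤ 1)
    (hDf : ∀ n u, |f n u| ≤ D * ‖u‖) (hDφ : ∀ u, |φ (q u)| ≤ D * ‖u‖) (hD : 0 ≤ D)
    (hpη : ∀ u, η * p (q u) ≤ ‖u‖) (hη0 : 0 < η)
    (μ : ℕ → ℝ) (k : ℕ → Z) (n : ℕ) (γ : ℝ) (u y : X) (hμ : ∀ i, 0 ≤ μ i) (hk : ∀ i, k i ∈ K i)
    (hn : ∀ i, n ≤ i → μ i = 0) (hγ : 0 ≤ γ) (hsum : ∑ i ∈ Finset.range n, μ i + γ ≤ 1)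
    (hu : ‖u‖ ≤ γ * η)
    (hy : y = ∑ i ∈ Finset.range n, μ i • (s + φ.smulRight (x i)) (k i) + u) (J : ℕ) :
    (∑ i ∈ Finset.range J, μ i + γ ≤ 1) ∧
    (p (q y - ∑ i ∈ Finset.range J, μ i • k i) ≤ 1 - ∑ i ∈ Finset.range J, μ i) ∧
    (|φ (q y) - ∑ i ∈ Finset.range J, μ i * φ (k i) - f J y| ≤ 2 * D * η * γ) ∧
    (n ≤ J → |f J y| ≤ D * η * γ) := by
  have hqy : q y = ∑ i ∈ Finset.range n, μ i • k i + q u := by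
    rw [hy]; simp [hqs, hqx]
  have hfy : f J y = ∑ i ∈ Finset.range n, μ i * (φ (k i) * if J ≤ i then 1 else 0) + f J u := by
    rw [hy]; simp only [map_add, map_sum, map_smul, add_apply,
      ContinuousLinearMap.smulRight_apply, smul_add, hfs, hfx, smul_eq_mul, mul_zero, zero_add]
  have hpu : p (q u) ≤ γ := by
    have := (hpη u).trans hu
    rw [mul_comm γ] at this
    exact le_of_mul_le_mul_left this hη0
  have hfu : |f J u| ≤ D * η * γ := (hDf J u).trans (by
    calc D * ‖u‖ ≤ D * (γ * η) := by gcongr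
      _ = D * η * γ := by ring)
  have hφu : |φ (q u)| ≤ D * η * γ := (hDφ u).trans (by
    calc D * ‖u‖ ≤ D * (γ * η) := by gcongr
      _ = D * η * γ := by ring)
  have hs1 := aux_split μ n J hn
  have hs2 := aux_split (fun i => μ i • k i) n J (fun i hi => by simp [hn i hi])
  have hs3 := aux_split (fun i => μ i * (φ (k i) * if J ≤ i then 1 else 0)) n J
    (fun i hi => by simp [hn i hi])
  have hpos : 0 ≤ ∑ i ∈ Finset.Ico J (max n J), μ i := Finset.sum_nonneg fun i _ => hμ i
  refine ⟨by linarith, ?_, ?_, ?_⟩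
  · rw [hqy, hs2]
    have h1 : p (∑ i ∈ Finset.Ico J (max n J), μ i • k i) ≤ ∑ i ∈ Finset.Ico J (max n J), μ i := by
      refine (Finset.le_sum_of_subadditive p (map_zero p).le (map_add_le_add p) _ _).trans ?_
      apply Finset.sum_le_sum
      intro i _
      rw [map_smul_eq_mul, Real.norm_eq_abs, abs_of_nonneg (hμ i)]
      exact mul_le_of_le_one_right (hμ i) (hK i _ (hk i))
    have h2 : ∑ i ∈ Finset.range J, μ i • k i + ∑ i ∈ Finset.Ico J (max n J), μ i • k i + q u
        - ∑ i ∈ Finset.range J, μ i • k i = ∑ i ∈ Finset.Ico J (max n J), μ i • k i + q u := by abel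
    rw [h2]
    have := map_add_le_add p (∑ i ∈ Finset.Ico J (max n J), μ i • k i) (q u)
    linarith
  · have h1 : ∑ i ∈ Finset.range J, μ i * (φ (k i) * if J ≤ i then (1:ℝ) else 0) = 0 := by
      apply Finset.sum_eq_zero
      intro i hi
      have : ¬ J ≤ i := not_le.2 (Finset.mem_range.1 hi)
      simp [this]
    have h2 : ∑ i ∈ Finset.Ico J (max n J), μ i * (φ (k i) * if J ≤ i then (1:ℝ) else 0)
        = ∑ i ∈ Finset.Ico J (max n J), μ i * φ (k i) := by
      apply Finset.sum_congr rfl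
      intro i hi
      simp [(Finset.mem_Ico.1 hi).1]
    have h3 : φ (q y) - ∑ i ∈ Finset.range J, μ i * φ (k i) - f J y = φ (q u) - f J u := by
      rw [hfy, hs3, h1, h2, hqy, hs2]
      simp only [map_add, map_sum, map_smul, smul_eq_mul]
      ring
    rw [h3]
    have := abs_sub (φ (q u)) (f J u)
    linarith
  · intro hnJ
    have h1 : ∑ i ∈ Finset.range n, μ i * (φ (k i) * if J ≤ i then (1:ℝ) else 0) = 0 := by
      apply Finset.sum_eq_zero
      intro i hi
      have : ¬ J ≤ i := not_le.2 ((Finset.mem_range.1 hi).trans_le hnJ)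
      simp [this]
    rw [hfy, h1, zero_add]
    exact hfu

theorem aux_ulim {E : Type*} [TopologicalSpace E] {K : Set E} (hK : IsCompact K) (g : ℕ → E)
    (hg : ∀ m, g m ∈ K) : ∃ a ∈ K, Tendsto g (hyperfilter ℕ : Filter ℕ) (𝓝 a) := by
  obtain ⟨a, ha, h⟩ := hK.ultrafilter_le_nhds ((hyperfilter ℕ).map g) (by
    rw [le_principal_iff]
    exact Filter.mem_map.2 (Filter.mem_of_superset Filter.univ_mem (fun m _ => hg m)))
  exact ⟨a, ha, h⟩

theorem aux_closure {X Z : Type*} [NormedAddCommGroup X] [NormedSpace ℝ X] [NormedAddCommGroup Z]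
    [NormedSpace ℝ Z] [FiniteDimensional ℝ Z]
    (q : X →L[ℝ] Z) (s : Z →L[ℝ] X) (x : ℕ → X) (f : ℕ → StrongDual ℝ X)
    (φ : StrongDual ℝ Z) (p : Seminorm ℝ Z) (hpc : Continuous p) (hp0 : ∀ z, p z = 0 → z = 0)
    (A : Set Z) (hA : Convex ℝ A) (h0A : (0 : Z) ∈ A)
    (K : ℕ → Set Z) (hKc : ∀ i, IsCompact (K i)) (hKA : ∀ i, K i ⊆ A) (R : ℝ)
    (hR : ∀ z ∈ A, ‖z‖ ≤ R) (δ : ℝ)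
    (hgood : ∀ e, p e ≤ 1 → |φ e| < δ → e ∈ A)
    (η D : ℝ) (hη : 0 ≤ η)
    (hqs : ∀ z, q (s z) = z) (hqx : ∀ n, q (x n) = 0) (hfs : ∀ n z, f n (s z) = 0)
    (hfx : ∀ j n, f j (x n) = if j ≤ n then 1 else 0)
    (hK : ∀ i, ∀ k ∈ K i, p k ≤ 1)
    (hDf : ∀ n u, |f n u| ≤ D * ‖u‖) (hDφ : ∀ u, |φ (q u)| ≤ D * ‖u‖) (hD : 0 ≤ D)
    (hpη : ∀ u, η * p (q u) ≤ ‖u‖) (hη0 : 0 < η) (hηδ : 3 * D * η < δ)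
    (y : X) (hy : y ∈ closure (auxS (fun i => s + φ.smulRight (x i)) K η)) : q y ∈ A := by
  obtain ⟨Y, hYS, hYy⟩ := mem_closure_iff_seq_limit.1 hy
  choose μ k n γ u h1 h2 h3 h4 h5 h6 h7 using hYS
  have lev := fun m => aux_level q s x f φ p K η D hη hqs hqx hfs hfx hK hDf hDφ hD hpη hη0
    (μ m) (k m) (n m) (γ m) (u m) (Y m) (h1 m) (h2 m) (h3 m) (h4 m) (h5 m) (h6 m) (h7 m)
  have hμ1 : ∀ m i, μ m i ∈ Set.Icc (0:ℝ) 1 := by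
    intro m i
    refine ⟨h1 m i, ?_⟩
    have a1 := (lev m (i+1)).1
    rw [Finset.sum_range_succ] at a1
    have := Finset.sum_nonneg (s := Finset.range i) (f := μ m) (fun i _ => h1 m i)
    have := h4 m
    linarith
  have hγ1 : ∀ m, γ m ∈ Set.Icc (0:ℝ) 1 := fun m =>
    ⟨h4 m, by have a1 := (lev m 0).1; simpa using a1⟩
  have hulim1 := fun i => aux_ulim isCompact_Icc (fun m => μ m i) (fun m => hμ1 m i)
  choose μ' hμ' hμlim using hulim1
  have hulim2 := fun i => aux_ulim (hKc i) (fun m => k m i) (fun m => h2 m i)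
  choose k' hk' hklim using hulim2
  obtain ⟨γ', hγ', hγlim⟩ := aux_ulim isCompact_Icc γ hγ1
  have hYlim : Tendsto Y (hyperfilter ℕ : Filter ℕ) (𝓝 y) := hYy.mono_left Nat.hyperfilter_le_atTop
  have hqlim : Tendsto (fun m => q (Y m)) (hyperfilter ℕ : Filter ℕ) (𝓝 (q y)) :=
    (q.continuous.tendsto y).comp hYlim
  have hs1 : ∀ J, Tendsto (fun m => ∑ i ∈ Finset.range J, μ m i) (hyperfilter ℕ : Filter ℕ)
      (𝓝 (∑ i ∈ Finset.range J, μ' i)) := fun J => tendsto_finsetSum _ fun i _ => hμlim i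
  have hs2 : ∀ J, Tendsto (fun m => ∑ i ∈ Finset.range J, μ m i • k m i) (hyperfilter ℕ : Filter ℕ)
      (𝓝 (∑ i ∈ Finset.range J, μ' i • k' i)) :=
    fun J => tendsto_finsetSum _ fun i _ => (hμlim i).smul (hklim i)
  have hs3 : ∀ J, Tendsto (fun m => ∑ i ∈ Finset.range J, μ m i * φ (k m i))
      (hyperfilter ℕ : Filter ℕ)
      (𝓝 (∑ i ∈ Finset.range J, μ' i * φ (k' i))) :=
    fun J => tendsto_finsetSum _ fun i _ =>
      (hμlim i).mul ((φ.continuous.tendsto _).comp (hklim i))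
  have ha : ∀ J, ∑ i ∈ Finset.range J, μ' i + γ' ≤ 1 := fun J =>
    le_of_tendsto ((hs1 J).add hγlim) (Eventually.of_forall fun m => (lev m J).1)
  have hb : ∀ J, p (q y - ∑ i ∈ Finset.range J, μ' i • k' i) ≤ 1 - ∑ i ∈ Finset.range J, μ' i :=
    fun J => le_of_tendsto_of_tendsto' ((hpc.tendsto _).comp (hqlim.sub (hs2 J)))
      (tendsto_const_nhds.sub (hs1 J)) (fun m => (lev m J).2.1)
  have hc : ∀ J, |φ (q y) - ∑ i ∈ Finset.range J, μ' i * φ (k' i) - f J y| ≤ 2 * D * η * γ' :=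
    fun J => le_of_tendsto_of_tendsto'
      ((((φ.continuous.tendsto _).comp hqlim).sub (hs3 J)).sub
        (((f J).continuous.tendsto _).comp hYlim)).abs
      (tendsto_const_nhds.mul hγlim) (fun m => (lev m J).2.2.1)
  have hd : ∀ ε > 0, ∀ᶠ J in atTop, |f J y| ≤ D * η * γ' + ε := by
    intro ε hε
    have hlim : Tendsto (fun m => D * ‖y - Y m‖ + D * η * γ m) (hyperfilter ℕ : Filter ℕ)
        (𝓝 (D * ‖y - y‖ + D * η * γ')) :=
      ((tendsto_const_nhds.sub hYlim).norm.const_mul D).add (hγlim.const_mul _)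
    rw [sub_self, norm_zero, mul_zero, zero_add] at hlim
    obtain ⟨m, hm⟩ := (hlim.eventually (gt_mem_nhds (lt_add_of_pos_right _ hε))).exists
    filter_upwards [eventually_ge_atTop (n m)] with J hJ
    have e1 := (lev m J).2.2.2 hJ
    have e2 := hDf J (y - Y m)
    have e3 : f J y = f J (y - Y m) + f J (Y m) := by rw [map_sub]; ring
    rw [e3]
    have := abs_add_le (f J (y - Y m)) (f J (Y m))
    linarith
  -- sums
  have hμs : Summable μ' := by
    apply summable_of_sum_range_le (c := 1) (fun i => (hμ' i).1)
    intro J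
    have := ha J
    have := hγ'.1
    linarith
  have hks : Summable (fun i => μ' i • k' i) := by
    apply Summable.of_norm_bounded (g := fun i => μ' i * R) (hμs.mul_right R)
    intro i
    rw [norm_smul, Real.norm_eq_abs, abs_of_nonneg (hμ' i).1]
    exact mul_le_mul_of_nonneg_left (hR _ (hKA i (hk' i))) (hμ' i).1
  set τ := 1 - ∑' i, μ' i with hτ
  set e := q y - ∑' i, μ' i • k' i with he
  have t1 := hμs.hasSum.tendsto_sum_nat
  have t2 := hks.hasSum.tendsto_sum_nat
  have hγτ : γ' ≤ τ := by
    have := le_of_tendsto (t1.add_const γ') (Eventually.of_forall ha)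
    linarith
  have hpe : p e ≤ τ := le_of_tendsto_of_tendsto' ((hpc.tendsto _).comp (tendsto_const_nhds.sub t2))
    (tendsto_const_nhds.sub t1) hb
  have hφe : |φ e| ≤ 3 * D * η * γ' := by
    apply le_of_forall_pos_le_add
    intro ε hε
    have hlim : Tendsto (fun J => |φ (q y - ∑ i ∈ Finset.range J, μ' i • k' i)|) atTop (𝓝 |φ e|) :=
      ((φ.continuous.tendsto _).comp (tendsto_const_nhds.sub t2)).abs
    apply le_of_tendsto hlim
    filter_upwards [hd ε hε] with J hJ
    have e1 := hc J
    have e2 : φ (q y - ∑ i ∈ Finset.range J, μ' i • k' i) =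
      (φ (q y) - ∑ i ∈ Finset.range J, μ' i * φ (k' i) - f J y) + f J y := by
      simp only [map_sub, map_sum, map_smul, smul_eq_mul]; ring
    rw [e2]
    have := abs_add_le (φ (q y) - ∑ i ∈ Finset.range J, μ' i * φ (k' i) - f J y) (f J y)
    linarith
  have hτ0 : 0 ≤ τ := hγ'.1.trans hγτ
  obtain ⟨e', he'A, he'⟩ : ∃ e' ∈ A, τ • e' = e := by
    rcases hτ0.eq_or_lt with h | h
    · refine ⟨0, h0A, ?_⟩
      have : p e = 0 := le_antisymm (by rw [h]; exact hpe) (apply_nonneg p e)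
      simp [hp0 e this]
    · refine ⟨τ⁻¹ • e, hgood _ ?_ ?_, by rw [smul_inv_smul₀ h.ne']⟩
      · rw [map_smul_eq_mul, Real.norm_eq_abs, abs_of_pos (inv_pos.2 h), inv_mul_le_iff₀ h]
        linarith
      · rw [map_smul, smul_eq_mul, abs_mul, abs_of_pos (inv_pos.2 h), inv_mul_lt_iff₀ h]
        calc |φ e| ≤ 3 * D * η * γ' := hφe
          _ ≤ 3 * D * η * τ := by gcongr
          _ < τ * δ := by rw [mul_comm τ]; gcongr
  let w : ℕ → ℝ := fun j => Nat.casesOn j τ μ'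
  let P : ℕ → Z := fun j => Nat.casesOn j e' k'
  apply aux_sigma_convex hA (w := w) (p := P)
  · rintro (_ | i)
    · exact hτ0
    · exact (hμ' i).1
  · rw [← hasSum_nat_add_iff' 1]
    have : (1 : ℝ) - ∑ i ∈ Finset.range 1, w i = ∑' i, μ' i := by simp [w, hτ]
    rw [this]
    exact hμs.hasSum
  · rintro (_ | i)
    · exact he'A
    · exact hKA i (hk' i)
  · rw [← hasSum_nat_add_iff' 1]
    have : q y - ∑ i ∈ Finset.range 1, w i • P i = ∑' i, μ' i • k' i := by
      simp only [Finset.sum_range_one]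
      show q y - τ • e' = _
      rw [he', he]; abel
    rw [this]
    exact hks.hasSum

theorem aux_cvx {Z : Type*} [AddCommGroup Z] [Module ℝ Z] {K : Set Z}
    (hK : Convex ℝ K) {a b : ℝ} (ha : 0 ≤ a) (hb : 0 ≤ b) {k l : Z} (hk : k ∈ K) (hl : l ∈ K) :
    ∃ m ∈ K, a • k + b • l = (a + b) • m := by
  rcases (add_nonneg ha hb).eq_or_lt with h | h
  · have ha0 : a = 0 := by linarith
    have hb0 : b = 0 := by linarith
    exact ⟨k, hk, by simp [ha0, hb0]⟩
  · refine ⟨(a / (a + b)) • k + (b / (a + b)) • l,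
      hK hk hl (by positivity) (by positivity) (by field_simp), ?_⟩
    rw [smul_add, smul_smul, smul_smul, mul_div_cancel₀ _ h.ne', mul_div_cancel₀ _ h.ne']

theorem auxS_convex {X Z : Type*} [NormedAddCommGroup X] [NormedSpace ℝ X] [NormedAddCommGroup Z]
    [NormedSpace ℝ Z] (T : ℕ → Z →L[ℝ] X) (K : ℕ → Set Z) (η : ℝ)
    (hK : ∀ i, Convex ℝ (K i)) : Convex ℝ (auxS T K η) := by
  rintro x ⟨μ, k, n, γ, u, h1, h2, h3, h4, h5, h6, h7⟩ y ⟨μ', k', n', γ', u', h1', h2', h3', h4', h5', h6', h7'⟩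
    a b ha hb hab
  have := fun i => aux_cvx (hK i) (mul_nonneg ha (h1 i)) (mul_nonneg hb (h1' i)) (h2 i) (h2' i)
  choose l hl hl' using this
  have e1 := aux_split μ n (max n n') h3
  have e1' := aux_split μ' n' (max n n') h3'
  have e2 := aux_split (fun i => μ i • T i (k i)) n (max n n') (fun i hi => by simp [h3 i hi])
  have e2' := aux_split (fun i => μ' i • T i (k' i)) n' (max n n') (fun i hi => by simp [h3' i hi])
  rw [max_eq_right (le_max_left n n'), Finset.Ico_self, Finset.sum_empty, add_zero] at e1 e2
  rw [max_eq_right (le_max_right n n'), Finset.Ico_self, Finset.sum_empty, add_zero] at e1' e2'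
  refine ⟨fun i => a * μ i + b * μ' i, l, max n n', a * γ + b * γ', a • u + b • u',
    fun i => add_nonneg (mul_nonneg ha (h1 i)) (mul_nonneg hb (h1' i)), hl, fun i hi => ?_,
    by positivity, ?_, ?_, ?_⟩
  · simp [h3 i ((le_max_left _ _).trans hi), h3' i ((le_max_right _ _).trans hi)]
  · rw [Finset.sum_add_distrib, ← Finset.mul_sum, ← Finset.mul_sum, ← e1, ← e1']
    nlinarith
  · refine (norm_add_le _ _).trans ?_
    rw [norm_smul, norm_smul, Real.norm_eq_abs, Real.norm_eq_abs, abs_of_nonneg ha, abs_of_nonneg hb]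
    nlinarith
  · have : ∀ i, (a * μ i + b * μ' i) • T i (l i) =
        a • (μ i • T i (k i)) + b • (μ' i • T i (k' i)) := by
      intro i
      rw [← map_smul, ← hl', map_add, map_smul, map_smul, smul_smul, smul_smul]
    simp only [this]
    rw [Finset.sum_add_distrib, ← Finset.smul_sum, ← Finset.smul_sum, ← e2, ← e2', h7, h7']
    simp only [smul_add]; abel

theorem aux_core {X Z : Type*} [NormedAddCommGroup X] [NormedSpace ℝ X] [NormedAddCommGroup Z]
    [NormedSpace ℝ Z] [FiniteDimensional ℝ Z]
    (q : X →L[ℝ] Z) (s : Z →L[ℝ] X) (x : ℕ → X) (f : ℕ → StrongDual ℝ X) (C : ℝ)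
    (hqs : ∀ z, q (s z) = z) (hqx : ∀ n, q (x n) = 0) (hfs : ∀ n z, f n (s z) = 0)
    (hfx : ∀ j n, f j (x n) = if j ≤ n then 1 else 0) (hx : ∀ n, ‖x n‖ ≤ C)
    (hf : ∀ n u, |f n u| ≤ C * ‖u‖) (hC : 0 < C)
    (φ : StrongDual ℝ Z) (p : Seminorm ℝ Z) (c₁ C₁ : ℝ) (hc₁ : 0 < c₁)
    (hp₁ : ∀ z, c₁ * ‖z‖ ≤ p z) (hp₂ : ∀ z, p z ≤ C₁ * ‖z‖)
    (A : Set Z) (hA : Convex ℝ A) (hsymm : ∀ u ∈ A, -u ∈ A) (F : ℕ → Set Z)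
    (hFc : ∀ n, IsClosed (F n)) (hF : A = ⋃ n, F n)
    (hU : {u | p u < 1} ⊆ A) (hB : A ⊆ {u | p u ≤ 1}) (δ : ℝ) (hδ : 0 < δ)
    (hgood : ∀ e, p e ≤ 1 → |φ e| < δ → e ∈ A) :
    ∃ N : X → ℝ, IsEquivNorm N ∧ q '' {x : X | N x ≤ 1} = A := by
  have h0A : (0 : Z) ∈ A := hU (by simp)
  have hpc : Continuous p := by
    have hC₁ : ∀ z, p z ≤ |C₁| * ‖z‖ := fun z => (hp₂ z).trans (by gcongr; exact le_abs_self _)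
    apply Seminorm.continuous_of_le (q := (|C₁|).toNNReal • normSeminorm ℝ Z)
    · show Continuous fun z => (|C₁|).toNNReal • ‖z‖
      fun_prop
    · intro z
      simpa [NNReal.smul_def] using hC₁ z
  have hR : ∀ z ∈ A, ‖z‖ ≤ c₁⁻¹ := by
    intro z hz
    have h1 : p z ≤ 1 := hB hz
    have h2 := (hp₁ z).trans h1
    rw [← one_div, le_div_iff₀ hc₁]; linarith
  let K : ℕ → Set Z := fun i => convexHull ℝ (insert 0 (F i ∪ -F i))
  have hFA : ∀ i, F i ⊆ A := fun i => hF ▸ subset_iUnion F i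
  have hKA : ∀ i, K i ⊆ A := by
    intro i
    apply convexHull_min _ hA
    rintro z (rfl | hz | hz)
    · exact h0A
    · exact hFA i hz
    · simpa using hsymm _ (hFA i hz)
  have hKc : ∀ i, IsCompact (K i) := by
    intro i
    have hFk : IsCompact (F i) := by
      apply Metric.isCompact_of_isClosed_isBounded (hFc i)
      exact (Metric.isBounded_closedBall (x := (0:Z)) (r := c₁⁻¹)).subset
        (fun z hz => by simpa using hR z (hFA i hz))
    apply aux_compact_hull
    exact (hFk.union hFk.neg).insert 0
  have hKconv : ∀ i, Convex ℝ (K i) := fun i => convex_convexHull ℝ _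
  have hK0 : ∀ i, (0 : Z) ∈ K i := fun i => subset_convexHull ℝ _ (mem_insert _ _)
  have hKneg : ∀ i, ∀ k ∈ K i, -k ∈ K i := by
    intro i
    have : K i ⊆ -K i := by
      apply convexHull_min _ (hKconv i).neg
      rintro z (rfl | hz | hz)
      · simpa using hK0 i
      · exact subset_convexHull ℝ _ (Or.inr (Or.inr (by simpa using hz)))
      · exact subset_convexHull ℝ _ (Or.inr (Or.inl hz))
    exact fun k hk => this hk
  let D := C + ‖φ‖ * ‖q‖
  have hD : 0 < D := by positivity
  let E := |C₁| * ‖q‖ + 1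
  have hE : 0 < E := by positivity
  obtain ⟨η, hη0, hη1, hη2⟩ : ∃ η > 0, 3 * D * η < δ ∧ η * E ≤ 1 := by
    refine ⟨min (δ / (6 * D)) E⁻¹, by positivity, ?_, ?_⟩
    · calc 3 * D * min (δ / (6 * D)) E⁻¹ ≤ 3 * D * (δ / (6 * D)) := by
            gcongr; exact min_le_left _ _
        _ = δ / 2 := by field_simp; norm_num
        _ < δ := by linarith
    · calc min (δ / (6 * D)) E⁻¹ * E ≤ E⁻¹ * E := by gcongr; exact min_le_right _ _
        _ = 1 := inv_mul_cancel₀ hE.ne'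
  have hDf : ∀ n u, |f n u| ≤ D * ‖u‖ := fun n u => (hf n u).trans (by
    gcongr
    have : 0 ≤ ‖φ‖ * ‖q‖ := by positivity
    simp only [D]; linarith)
  have hDφ : ∀ u, |φ (q u)| ≤ D * ‖u‖ := by
    intro u
    have e1 := φ.le_opNorm (q u)
    have e2 := mul_le_mul_of_nonneg_left (q.le_opNorm u) (norm_nonneg φ)
    have e3 : 0 ≤ C * ‖u‖ := by positivity
    rw [Real.norm_eq_abs] at e1
    simp only [D]; nlinarith
  have hpη : ∀ u, η * p (q u) ≤ ‖u‖ := by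
    intro u
    have e1 : p (q u) ≤ E * ‖u‖ := by
      calc p (q u) ≤ C₁ * ‖q u‖ := hp₂ _
        _ ≤ |C₁| * (‖q‖ * ‖u‖) := by
          gcongr
          · exact le_abs_self _
          · exact q.le_opNorm u
        _ ≤ E * ‖u‖ := by
          have := norm_nonneg u
          simp only [E]; nlinarith
    calc η * p (q u) ≤ η * (E * ‖u‖) := by gcongr
      _ = (η * E) * ‖u‖ := by ring
      _ ≤ 1 * ‖u‖ := by gcongr
      _ = ‖u‖ := one_mul _
  let T : ℕ → Z →L[ℝ] X := fun i => s + φ.smulRight (x i)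
  let S := auxS T K η
  have hSc : Convex ℝ S := auxS_convex T K η hKconv
  have hSneg : ∀ y ∈ S, -y ∈ S := by
    rintro y ⟨μ, k, n, γ, u, h1, h2, h3, h4, h5, h6, h7⟩
    refine ⟨μ, fun i => -k i, n, γ, -u, h1, fun i => hKneg i _ (h2 i), h3, h4, h5, by simpa using h6, ?_⟩
    rw [h7]; simp only [map_neg, smul_neg, Finset.sum_neg_distrib]; abel
  have hSball : Metric.ball (0 : X) η ⊆ S := by
    intro u hu
    refine ⟨0, 0, 0, 1, u, by simp, hK0, by simp, zero_le_one, by simp, ?_, by simp⟩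
    rw [one_mul]; exact (mem_ball_zero_iff.1 hu).le
  have hSnhds : S ∈ 𝓝 (0 : X) := Filter.mem_of_superset (Metric.ball_mem_nhds 0 hη0) hSball
  let R := (‖s‖ + ‖φ‖ * C) * c₁⁻¹ + η
  have hR0 : 0 < R := by positivity
  have hSb : S ⊆ Metric.closedBall 0 R := by
    rintro y ⟨μ, k, n, γ, u, h1, h2, h3, h4, h5, h6, h7⟩
    rw [mem_closedBall_zero_iff]
    have hT : ∀ i, ‖T i (k i)‖ ≤ (‖s‖ + ‖φ‖ * C) * c₁⁻¹ := by
      intro i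
      have hk := hR _ (hKA i (h2 i))
      have e1 : ‖T i (k i)‖ ≤ ‖s (k i)‖ + ‖φ (k i)‖ * ‖x i‖ := by
        simp only [T, add_apply, ContinuousLinearMap.smulRight_apply]
        exact (norm_add_le _ _).trans (by rw [norm_smul])
      calc ‖T i (k i)‖ ≤ ‖s (k i)‖ + ‖φ (k i)‖ * ‖x i‖ := e1
        _ ≤ ‖s‖ * ‖k i‖ + (‖φ‖ * ‖k i‖) * C := by
          gcongr
          · exact s.le_opNorm _
          · exact φ.le_opNorm _
          · exact hx i
        _ = (‖s‖ + ‖φ‖ * C) * ‖k i‖ := by ring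
        _ ≤ _ := by gcongr
    have hsumT : ‖∑ i ∈ Finset.range n, μ i • T i (k i)‖ ≤
        (∑ i ∈ Finset.range n, μ i) * ((‖s‖ + ‖φ‖ * C) * c₁⁻¹) := by
      rw [Finset.sum_mul]
      apply norm_sum_le_of_le
      intro i _
      rw [norm_smul, Real.norm_eq_abs, abs_of_nonneg (h1 i)]
      exact mul_le_mul_of_nonneg_left (hT i) (h1 i)
    have hs0 : 0 ≤ ∑ i ∈ Finset.range n, μ i := Finset.sum_nonneg fun i _ => h1 i
    have hq0 : 0 ≤ (‖s‖ + ‖φ‖ * C) * c₁⁻¹ := by positivity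
    calc ‖y‖ ≤ ‖∑ i ∈ Finset.range n, μ i • T i (k i)‖ + ‖u‖ := by rw [h7]; exact norm_add_le _ _
      _ ≤ (∑ i ∈ Finset.range n, μ i) * ((‖s‖ + ‖φ‖ * C) * c₁⁻¹) + γ * η := add_le_add hsumT h6
      _ ≤ 1 * ((‖s‖ + ‖φ‖ * C) * c₁⁻¹) + 1 * η := by
        gcongr <;> linarith
      _ = R := by simp only [R]; ring
  have habs : Absorbent ℝ S := absorbent_nhds_zero hSnhds
  refine ⟨gauge S, ⟨gauge_add_le hSc habs, ?_, R⁻¹, η⁻¹, by positivity, fun y => ⟨?_, ?_⟩⟩, ?_⟩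
  · intro c y
    rcases le_total 0 c with h | h
    · rw [gauge_smul_of_nonneg h, abs_of_nonneg h, smul_eq_mul]
    · have : c • y = -((-c) • y) := by simp
      rw [this, gauge_neg hSneg, gauge_smul_of_nonneg (neg_nonneg.2 h), abs_of_nonpos h, smul_eq_mul]
  · have := le_gauge_of_subset_closedBall habs hR0.le hSb (x := y)
    rwa [div_eq_inv_mul] at this
  · have := mul_gauge_le_norm hSball (x := y)
    rw [inv_mul_eq_div, le_div_iff₀ hη0]; linarith
  · apply Subset.antisymm
    · rintro _ ⟨y, hy, rfl⟩
      have hy' : y ∈ closure S := (gauge_le_one_iff_mem_closure hSc hSnhds).1 hy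
      refine aux_closure q s x f φ p hpc ?_ A hA h0A K hKc hKA c₁⁻¹ hR δ hgood η D hη0.le hqs hqx hfs
        hfx (fun i k hk => hB (hKA i hk)) hDf hDφ hD.le hpη hη0 hη1 y hy'
      intro z hz
      have h1 := hp₁ z
      rw [hz] at h1
      have : ‖z‖ ≤ 0 := nonpos_of_mul_nonpos_right h1 hc₁
      simpa using this
    · intro z hz
      rw [hF] at hz
      obtain ⟨n, hn⟩ := mem_iUnion.1 hz
      have hzK : z ∈ K n := subset_convexHull ℝ _ (Or.inr (Or.inl hn))
      refine ⟨T n z, ?_, by simp [T, hqs, hqx]⟩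
      apply gauge_le_one_of_mem
      refine ⟨fun i => if i = n then 1 else 0, fun i => if i = n then z else 0, n + 1, 0, 0, ?_, ?_, ?_,
        le_rfl, ?_, by simp, ?_⟩
      · intro i; dsimp only; split_ifs <;> norm_num
      · intro i; dsimp only; split_ifs with h
        · rw [h]; exact hzK
        · exact hK0 i
      · intro i hi
        have : i ≠ n := by omega
        simp [this]
      · simp
      · simp

theorem aux_seq {X : Type*} [NormedAddCommGroup X] [NormedSpace ℝ X] [CompleteSpace X]
    (hnonrefl : ¬ Function.Surjective (NormedSpace.inclusionInDoubleDual ℝ X))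
    (Y : Submodule ℝ X) [hYc : IsClosed (Y : Set X)] [FiniteDimensional ℝ (X ⧸ Y)] :
    ∃ (s : (X ⧸ Y) →L[ℝ] X) (x : ℕ → X) (f : ℕ → StrongDual ℝ X) (C : ℝ),
      (∀ z, Y.mkQL (s z) = z) ∧ (∀ n, Y.mkQL (x n) = 0) ∧ (∀ n z, f n (s z) = 0) ∧
      (∀ j n, f j (x n) = if j ≤ n then 1 else 0) ∧ (∀ n, ‖x n‖ ≤ C) ∧
      (∀ n u, |f n u| ≤ C * ‖u‖) ∧ 0 < C := by
  obtain ⟨s0, hs0⟩ := (Y.mkQ).exists_rightInverse_of_surjective (Submodule.range_mkQ Y)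
  let s : (X ⧸ Y) →L[ℝ] X := LinearMap.toContinuousLinearMap s0
  let q : X →L[ℝ] (X ⧸ Y) := Y.mkQL
  have hqs : ∀ z, q (s z) = z := fun z => LinearMap.congr_fun hs0 z
  have hq0 : ∀ y : X, q y = 0 ↔ y ∈ Y := fun y => Submodule.Quotient.mk_eq_zero Y
  let P : X →L[ℝ] Y := (ContinuousLinearMap.id ℝ X - s.comp q).codRestrict Y (by
    intro y
    rw [← hq0]
    simp [hqs])
  have hP : ∀ y, (P y : X) = y - s (q y) := fun y => rfl
  have hPs : ∀ z, P (s z) = 0 := by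
    intro z; apply Subtype.ext; rw [hP, hqs]; simp
  have hPY : ∀ y : Y, P y = y := by
    intro y; apply Subtype.ext; rw [hP, (hq0 y).2 y.2]; simp
  have : CompleteSpace Y := hYc.completeSpace_coe
  have hYn : ¬ Function.Surjective (NormedSpace.inclusionInDoubleDual ℝ Y) := by
    intro hY
    apply hnonrefl
    intro ξ
    let Pd : StrongDual ℝ Y →L[ℝ] StrongDual ℝ X := (ContinuousLinearMap.compL ℝ X Y ℝ).flip P
    let qd : StrongDual ℝ (X ⧸ Y) →L[ℝ] StrongDual ℝ X :=
      (ContinuousLinearMap.compL ℝ X (X ⧸ Y) ℝ).flip q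
    obtain ⟨y, hy⟩ := hY (ξ.comp Pd)
    obtain ⟨z, hz⟩ := aux_fd_reflexive (ξ.comp qd)
    refine ⟨y + s z, ?_⟩
    ext g
    have e1 : g = Pd (g.comp Y.subtypeL) + qd (g.comp s) := by
      ext t
      show g t = g (P t : X) + g (s (q t))
      rw [hP, map_sub]; ring
    have e2 : ξ (Pd (g.comp Y.subtypeL)) = g y := by
      have := congrArg (fun L : StrongDual ℝ (StrongDual ℝ Y) => L (g.comp Y.subtypeL)) hy
      exact this.symm
    have e3 : ξ (qd (g.comp s)) = g (s z) := hz (g.comp s)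
    rw [NormedSpace.dual_def, map_add]
    conv_rhs => rw [e1, map_add, e2, e3]
  obtain ⟨C, x, g, hC, hx, hg, hgx⟩ := aux_james hYn
  refine ⟨s, fun n => (x n : X), fun n => (g n).comp P, C * (‖P‖ + 1), hqs, fun n => (hq0 _).2 (x n).2,
    fun n z => ?_, fun j n => ?_, fun n => ?_, fun n u => ?_, by positivity⟩
  · simp [hPs]
  · rw [← hgx j n, ContinuousLinearMap.comp_apply, hPY]
  · have h1 : ‖(x n : X)‖ ≤ C := hx n
    have := norm_nonneg P
    nlinarith
  · have e1 : |g n (P u)| ≤ ‖g n‖ * ‖P u‖ := (g n).le_opNorm _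
    calc |g n (P u)| ≤ ‖g n‖ * ‖P u‖ := e1
      _ ≤ C * ((‖P‖ + 1) * ‖u‖) := by
        gcongr
        · exact hg n
        · exact (P.le_opNorm u).trans (by gcongr; linarith)
      _ = C * (‖P‖ + 1) * ‖u‖ := by ring

end Aux

open Filter Topology in
/-- Let `X` be a non-reflexive Banach space, `Y ⊆ X` a closed subspace of
codimension `d`, and `q : X → X ⧸ Y` the quotient map.  Let `M` be an equivalent norm on
`X ⧸ Y` and `A ⊆ X ⧸ Y` a symmetric convex `F_σ` set with `U_M ⊆ A ⊆ B_M`, admitting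
`v ∈ ∂A` and `r ∈ (0,1)` such that `A ∖ (U_M(v,r) ∪ U_M(-v,r))` is closed.  Then `X` admits
an equivalent norm `N` such that `q` maps the `N`-closed unit ball exactly onto `A`. -/
theorem stmt13 {X : Type*} [NormedAddCommGroup X] [NormedSpace ℝ X] [CompleteSpace X]
    (hnonrefl : ¬ Function.Surjective (NormedSpace.inclusionInDoubleDual ℝ X))
    (d : ℕ) (Y : Submodule ℝ X) [IsClosed (Y : Set X)]
    [FiniteDimensional ℝ (X ⧸ Y)] (hd : Module.finrank ℝ (X ⧸ Y) = d)
    (M : (X ⧸ Y) → ℝ) (hM : IsEquivNorm M)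
    (A : Set (X ⧸ Y)) (hsymm : ∀ u ∈ A, -u ∈ A) (hconv : Convex ℝ A)
    (hFsigma : ∃ F : ℕ → Set (X ⧸ Y), (∀ n, IsClosed (F n)) ∧ A = ⋃ n, F n)
    (hU : {u : X ⧸ Y | M u < 1} ⊆ A) (hB : A ⊆ {u : X ⧸ Y | M u ≤ 1})
    (v : X ⧸ Y) (hv : v ∈ frontier A) (r : ℝ) (hr : r ∈ Set.Ioo (0 : ℝ) 1)
    (hclosed : IsClosed
      (A \ ({u : X ⧸ Y | M (u - v) < r} ∪ {u : X ⧸ Y | M (u + v) < r}))) :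
    ∃ N : X → ℝ, IsEquivNorm N ∧
      (Submodule.Quotient.mk (p := Y)) '' {x : X | N x ≤ 1} = A := by
  have hYc : IsClosed (Y : Set X) := inferInstance
  obtain ⟨s, x, f, C, hqs, hqx, hfs, hfx, hx, hf, hC⟩ := aux_seq hnonrefl Y
  obtain ⟨hM1, hM2, c₁, C₁, hc₁, hM3⟩ := hM
  obtain ⟨F, hFc, hF⟩ := hFsigma
  let p : Seminorm ℝ (X ⧸ Y) := Seminorm.of M hM1 (fun a z => by rw [hM2, Real.norm_eq_abs])
  have hpM : ∀ z, p z = M z := fun z => rfl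
  have hMc : Continuous M := by
    have hC₁ : ∀ z, p z ≤ |C₁| * ‖z‖ := fun z => (hM3 z).2.trans (by gcongr; exact le_abs_self _)
    show Continuous p
    apply Seminorm.continuous_of_le (q := (|C₁|).toNNReal • normSeminorm ℝ (X ⧸ Y))
    · show Continuous fun z => (|C₁|).toNNReal • ‖z‖
      fun_prop
    · intro z
      simpa [NNReal.smul_def] using hC₁ z
  have hMneg : ∀ z, M (-z) = M z := fun z => by
    rw [← hpM, ← hpM, map_neg_eq_map]
  -- the functional
  have hUo : IsOpen {u : X ⧸ Y | M u < 1} := isOpen_lt hMc continuous_const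
  have hUc : Convex ℝ {u : X ⧸ Y | M u < 1} := by
    have := p.convex_ball 0 1
    rwa [Seminorm.ball_zero_eq] at this
  have hvU : v ∉ {u : X ⧸ Y | M u < 1} := fun h => hv.2 (interior_maximal hU hUo h)
  obtain ⟨g, hg⟩ := geometric_hahn_banach_open_point hUc hUo hvU
  have hM0 : M 0 = 0 := by rw [← hpM, map_zero]
  have hgv : 0 < g v := by
    have := hg 0 (by simp [hM0])
    simpa using this
  let φ : StrongDual ℝ (X ⧸ Y) := (g v)⁻¹ • g
  have hφ : ∀ z, φ z = (g v)⁻¹ * g z := fun z => rfl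
  have hφv : φ v = 1 := by rw [hφ, inv_mul_cancel₀ hgv.ne']
  have hφ1 : ∀ z, φ z ≤ M z := by
    intro z
    apply le_of_forall_gt_imp_ge_of_dense
    intro t ht
    have ht0 : 0 < t := lt_of_le_of_lt (apply_nonneg p z) ht
    have h1 : M (t⁻¹ • z) < 1 := by
      rw [hM2, abs_of_pos (inv_pos.2 ht0), inv_mul_lt_iff₀ ht0]; linarith
    have h2 := hg _ h1
    rw [map_smul, smul_eq_mul, inv_mul_lt_iff₀ ht0] at h2
    rw [hφ, inv_mul_le_iff₀ hgv]
    linarith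
  have hr1 : 0 < 1 - r := by linarith [hr.2]
  have key := aux_core Y.mkQL s x f C hqs hqx hfs hfx hx hf hC φ p c₁ C₁ hc₁ (fun z => (hM3 z).1)
    (fun z => (hM3 z).2) A hconv hsymm F hFc hF hU hB (1 - r) hr1 (by
      intro e he hφe
      have hlim : Tendsto (fun n : ℕ => (1 - 1 / ((n : ℝ) + 1)) • e) atTop (𝓝 e) := by
        have h1 : Tendsto (fun n : ℕ => (1 - 1 / ((n : ℝ) + 1))) atTop (𝓝 (1 - 0)) :=
          tendsto_const_nhds.sub tendsto_one_div_add_atTop_nhds_zero_nat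
        have := h1.smul_const e
        simpa using this
      have hmem := hclosed.mem_of_tendsto hlim (Eventually.of_forall fun n => by
        have hn : 0 < 1 / ((n : ℝ) + 1) := by positivity
        have hn1 : 1 / ((n : ℝ) + 1) ≤ 1 := by
          rw [div_le_one (by positivity)]; linarith [Nat.cast_nonneg (α := ℝ) n]
        set t := 1 - 1 / ((n : ℝ) + 1) with ht
        have ht0 : 0 ≤ t := by linarith
        have ht1 : t < 1 := by linarith
        have hφt : |φ (t • e)| < 1 - r := by
          rw [map_smul, smul_eq_mul, abs_mul, abs_of_nonneg ht0]
          have := abs_nonneg (φ e)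
          nlinarith
        obtain ⟨hl, hu⟩ := abs_lt.1 hφt
        refine ⟨hU ?_, ?_⟩
        · show M (t • e) < 1
          rw [hM2, abs_of_nonneg ht0]
          have he' : M e ≤ 1 := he
          have : 0 ≤ M e := apply_nonneg p e
          nlinarith
        · rintro (h | h)
          · have h1 : M (t • e - v) < r := h
            have h2 := hφ1 (-(t • e - v))
            rw [hMneg, map_neg, map_sub, hφv] at h2
            linarith
          · have h1 : M (t • e + v) < r := h
            have h2 := hφ1 (t • e + v)
            rw [map_add, hφv] at h2
            linarith)
      exact hmem.1)
  obtain ⟨N, hN, hNA⟩ := key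
  exact ⟨N, hN, hNA⟩
end

section
/- Let X be a non-reflexive Banach space and Y ⊆ X a closed linear subspace of finite codimension d ≥ 2. Then X admits an equivalent norm |‖·‖| such that, with respect to |‖·‖|, Y⊥ ⊆ NA(X) but Y is not proximinal in X. -/
/-- A continuous linear functional `f` attains its norm with respect to the (equivalent)
norm `N`: there is `x` in the `N`-closed unit ball at which `f` equals its supremum over
that ball (i.e. its `N`-dual norm). -/
def AttainsWrt {X : Type*} [SeminormedAddCommGroup X] [NormedSpace ℝ X] (N : X → ℝ)
    (f : X →L[ℝ] ℝ) : Prop :=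
  ∃ x : X, N x ≤ 1 ∧ f x = sSup ((fun z => f z) '' {z : X | N z ≤ 1})

/-- `F` is proximinal with respect to the (equivalent) norm `N`: every `x` has a point of `F`
realizing the `N`-distance from `x` to `F`. -/
def ProximinalWrt {X : Type*} [SeminormedAddCommGroup X] [NormedSpace ℝ X] (N : X → ℝ)
    (F : Set X) : Prop :=
  ∀ x : X, ∃ y ∈ F, N (x - y) = sInf ((fun z => N (x - z)) '' F)

section AuxSec
set_option maxSynthPendingDepth 3
open Metric Set

lemma aux_ext {W : Type*} [NormedAddCommGroup W] [NormedSpace ℝ W]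
    (G : StrongDual ℝ W) (δ : ℝ) (hδ : 0 < δ) (M : Submodule ℝ W)
    (hM : ∀ f ∈ M, ‖f‖ ≤ 1 → G f ≤ δ) :
    ∃ H : StrongDual ℝ W, ‖H‖ ≤ δ ∧ ∀ f ∈ M, H f = G f := by
  let g : StrongDual ℝ M := G.comp M.subtypeL
  have hg : ‖g‖ ≤ δ := by
    have key : ∀ f : M, g f ≤ δ * ‖f‖ := by
      intro f
      by_cases hf : ‖f‖ = 0
      · have : f = 0 := norm_eq_zero.1 hf
        simp [this]
      have hpos : 0 < ‖f‖ := lt_of_le_of_ne (norm_nonneg _) (Ne.symm hf)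
      have h1 := hM ((‖f‖)⁻¹ • (f : W)) (M.smul_mem _ f.2) (by
        rw [norm_smul, norm_inv, norm_norm]
        rw [Submodule.coe_norm]
        rw [inv_mul_cancel₀]
        exact hf)
      rw [map_smul, smul_eq_mul, inv_mul_le_iff₀ hpos] at h1
      rw [mul_comm]
      exact h1
    refine ContinuousLinearMap.opNorm_le_bound _ hδ.le ?_
    intro f
    rw [Real.norm_eq_abs, abs_le]
    refine ⟨?_, key f⟩
    have := key (-f)
    rw [map_neg, norm_neg] at this
    linarith
  obtain ⟨H, hH, hHn⟩ := exists_extension_norm_eq M g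
  exact ⟨H, hHn.trans_le hg, fun f hf => hH ⟨f, hf⟩⟩

lemma aux_step1 {Y : Type*} [NormedAddCommGroup Y] [NormedSpace ℝ Y]
    (G : StrongDual ℝ (StrongDual ℝ Y)) (δ : ℝ) (hδ : 0 < δ)
    (hG : ∀ y : Y, δ < ‖G - NormedSpace.inclusionInDoubleDual ℝ Y y‖) (S : Finset Y) :
    ∃ f : StrongDual ℝ Y, ‖f‖ ≤ 1 ∧ (∀ y ∈ S, f y = 0) ∧ δ < G f := by
  by_contra hcon
  push Not at hcon
  let M : Submodule ℝ (StrongDual ℝ Y) :=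
    { carrier := {f | ∀ y ∈ S, f y = 0}
      add_mem' := by
        intro a b ha hb y hy
        simp [ha y hy, hb y hy]
      zero_mem' := by intro y hy; simp
      smul_mem' := by
        intro c a ha y hy
        simp [ha y hy] }
  obtain ⟨H, hHn, hH⟩ := aux_ext G δ hδ M (fun f hf hn => hcon f hn hf)
  have hmem : ((G - H : StrongDual ℝ (StrongDual ℝ Y)) : StrongDual ℝ Y →ₗ[ℝ] ℝ) ∈
      Submodule.span ℝ (Set.range fun y : S =>
        ((NormedSpace.inclusionInDoubleDual ℝ Y (y : Y) : StrongDual ℝ (StrongDual ℝ Y)) :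
          StrongDual ℝ Y →ₗ[ℝ] ℝ)) := by
    refine mem_span_of_iInf_ker_le_ker ?_
    intro f hf
    simp only [Submodule.mem_iInf, LinearMap.mem_ker] at hf
    have hfM : f ∈ M := by
      intro y hy
      exact hf ⟨y, hy⟩
    have := hH f hfM
    rw [LinearMap.mem_ker]
    show G f - H f = 0
    rw [this, sub_self]
  obtain ⟨c, hc⟩ := (Submodule.mem_span_range_iff_exists_fun ℝ).1 hmem
  have h2 := hG (∑ y : S, c y • (y : Y))
  have h3 : G - NormedSpace.inclusionInDoubleDual ℝ Y (∑ y : S, c y • (y : Y)) = H := by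
    ext f
    have := congrArg (fun L => L f) hc
    simp [NormedSpace.dual_def] at this
    simp [NormedSpace.dual_def]
    linarith
  rw [h3] at h2
  linarith

lemma aux_step2 {Y : Type*} [NormedAddCommGroup Y] [NormedSpace ℝ Y]
    (G : StrongDual ℝ (StrongDual ℝ Y)) (hG1 : ‖G‖ ≤ 1) (θ : ℝ) (hθ : 0 < θ)
    (T : Finset (StrongDual ℝ Y)) (hT : ∀ f ∈ T, 2 * θ < G f) :
    ∃ y : Y, ‖y‖ ≤ 1 ∧ ∀ f ∈ T, θ < f y := by
  classical
  let R : Y →L[ℝ] (T → ℝ) := ContinuousLinearMap.pi fun f => (f : StrongDual ℝ Y)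
  let v : T → ℝ := fun f => G f
  have hv : v ∈ closure (R '' closedBall 0 1) := by
    by_contra hv
    have hconv : Convex ℝ (closure (R '' closedBall 0 1)) :=
      ((convex_closedBall (0 : Y) 1).linear_image (R : Y →ₗ[ℝ] (T → ℝ))).closure
    obtain ⟨L, u, h1, h2⟩ := geometric_hahn_banach_closed_point hconv isClosed_closure hv
    let g : StrongDual ℝ Y := L.comp R
    have hg : g = ∑ f : T, L (Pi.single f 1) • (f : StrongDual ℝ Y) := by
      ext y
      show L (R y) = _
      conv_lhs => rw [← Finset.univ_sum_single (R y)]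
      rw [map_sum]
      simp only [sum_apply, smul_apply, smul_eq_mul]
      refine Finset.sum_congr rfl fun f _ => ?_
      have : (Pi.single f (R y f) : T → ℝ) = (R y f) • Pi.single f 1 := by
        rw [← Pi.single_smul]; simp
      rw [this, map_smul, smul_eq_mul, mul_comm]; rfl
    have hGg : G g = L v := by
      rw [hg, map_sum]
      conv_rhs => rw [← Finset.univ_sum_single v]
      rw [map_sum]
      refine Finset.sum_congr rfl fun f _ => ?_
      have : (Pi.single f (v f) : T → ℝ) = (v f) • Pi.single f 1 := by
        rw [← Pi.single_smul]; simp
      rw [this, map_smul, map_smul, smul_eq_mul, smul_eq_mul, mul_comm]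
    have hgu : ∀ y : Y, ‖y‖ ≤ 1 → g y < u := by
      intro y hy
      exact h1 _ (subset_closure ⟨y, by simpa using hy, rfl⟩)
    have hu : 0 < u := by simpa using hgu 0 (by simp)
    have hgn : ‖g‖ ≤ u := by
      refine ContinuousLinearMap.opNorm_le_of_unit_norm hu.le ?_
      intro y hy
      rw [Real.norm_eq_abs, abs_le]
      have a1 := hgu y hy.le
      have a2 := hgu (-y) (by rw [norm_neg]; exact hy.le)
      rw [map_neg] at a2
      constructor <;> linarith
    have h4 : G g ≤ ‖g‖ := by
      calc G g ≤ ‖G g‖ := Real.le_norm_self _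
        _ ≤ ‖G‖ * ‖g‖ := G.le_opNorm g
        _ ≤ 1 * ‖g‖ := by gcongr
        _ = ‖g‖ := one_mul _
    linarith
  obtain ⟨_, ⟨y, hy, rfl⟩, hd⟩ := Metric.mem_closure_iff.1 hv θ hθ
  refine ⟨y, by simpa using hy, fun f hf => ?_⟩
  have h1 := (dist_le_pi_dist v (R y) ⟨f, hf⟩).trans_lt hd
  rw [Real.dist_eq] at h1
  have h2 := (abs_lt.1 h1).2
  have h3 : v ⟨f, hf⟩ = G f := rfl
  have h4 : R y ⟨f, hf⟩ = f y := rfl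
  have := hT f hf
  linarith

lemma aux_seq_s14 {Y : Type*} [NormedAddCommGroup Y] [NormedSpace ℝ Y] [CompleteSpace Y]
    (h : ¬ Function.Surjective (NormedSpace.inclusionInDoubleDual ℝ Y)) :
    ∃ (θ : ℝ) (y : ℕ → Y) (f : ℕ → StrongDual ℝ Y), 0 < θ ∧ (∀ n, ‖y n‖ ≤ 1) ∧
      (∀ n, ‖f n‖ ≤ 1) ∧ (∀ j k, j < k → f k (y j) = 0) ∧ ∀ j k, k ≤ j → θ < f k (y j) := by
  classical
  simp only [Function.Surjective, not_forall] at h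
  obtain ⟨G0, hG0⟩ := h
  have hne : G0 ≠ 0 := by
    rintro rfl
    exact hG0 ⟨0, map_zero _⟩
  have hn0 : 0 < ‖G0‖ := (norm_pos_iff (a := G0)).2 hne
  let G := ‖G0‖⁻¹ • G0
  have hGn : ‖G‖ ≤ 1 := by
    simp only [G]
    rw [norm_smul, norm_inv, norm_norm, inv_mul_cancel₀ hn0.ne']
  have hGr : G ∉ Set.range (NormedSpace.inclusionInDoubleDual ℝ Y) := by
    rintro ⟨y, hy⟩
    refine hG0 ⟨‖G0‖ • y, ?_⟩
    rw [map_smul, hy, smul_smul, mul_inv_cancel₀ hn0.ne', one_smul]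
  have hcl : IsClosed (Set.range (NormedSpace.inclusionInDoubleDual ℝ Y)) :=
    (NormedSpace.inclusionInDoubleDualLi (E := Y) ℝ).isometry.isClosedEmbedding.isClosed_range
  have hpos : 0 < infDist G (Set.range (NormedSpace.inclusionInDoubleDual ℝ Y)) :=
    (hcl.notMem_iff_infDist_pos ⟨0, 0, map_zero _⟩).1 hGr
  set δ := infDist G (Set.range (NormedSpace.inclusionInDoubleDual ℝ Y)) with hδ
  have hδ' : ∀ y : Y, δ / 2 < ‖G - NormedSpace.inclusionInDoubleDual ℝ Y y‖ := by
    intro y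
    have := infDist_le_dist_of_mem (x := G) (Set.mem_range_self (f := NormedSpace.inclusionInDoubleDual ℝ Y) y)
    rw [dist_eq_norm] at this
    linarith
  obtain ⟨s, hs1, hs2⟩ := exists_seq_of_forall_finset_exists
    (fun p : Y × StrongDual ℝ Y => ‖p.1‖ ≤ 1 ∧ ‖p.2‖ ≤ 1 ∧ δ / 2 < G p.2 ∧ δ / 4 < p.2 p.1)
    (fun p q => q.2 p.1 = 0 ∧ δ / 4 < p.2 q.1) (by
      intro s hs
      obtain ⟨f, hf1, hf2, hf3⟩ := aux_step1 G (δ / 2) (by positivity) hδ' (s.image Prod.fst)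
      obtain ⟨y, hy1, hy2⟩ := aux_step2 G hGn (δ / 4) (by positivity)
        (insert f (s.image Prod.snd)) (by
          intro g hg
          rw [Finset.mem_insert, Finset.mem_image] at hg
          rcases hg with rfl | ⟨p, hp, rfl⟩
          · linarith
          · have := (hs p hp).2.2.1
            linarith)
      refine ⟨(y, f), ⟨hy1, hf1, hf3, hy2 f (by simp)⟩, fun p hp => ⟨?_, ?_⟩⟩
      · exact hf2 _ (Finset.mem_image_of_mem _ hp)
      · exact hy2 _ (Finset.mem_insert_of_mem (Finset.mem_image_of_mem _ hp)))
  refine ⟨δ / 4, fun n => (s n).1, fun n => (s n).2, by positivity, fun n => (hs1 n).1,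
    fun n => (hs1 n).2.1, fun j k hjk => (hs2 j k hjk).1, fun j k hkj => ?_⟩
  rcases hkj.eq_or_lt with rfl | hlt
  · exact (hs1 _).2.2.2
  · exact (hs2 _ _ hlt).2

lemma aux_convex_infDist {E : Type*} [NormedAddCommGroup E] [NormedSpace ℝ E] {D : Set E}
    (hD : Convex ℝ D) (hne : D.Nonempty) (x y : E) (a b : ℝ) (ha : 0 ≤ a) (hb : 0 ≤ b)
    (hab : a + b = 1) : infDist (a • x + b • y) D ≤ a * infDist x D + b * infDist y D := by
  refine le_of_forall_pos_le_add fun ε hε => ?_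
  obtain ⟨z, hz, hz'⟩ := (infDist_lt_iff hne).1 (lt_add_of_pos_right (infDist x D) hε)
  obtain ⟨w, hw, hw'⟩ := (infDist_lt_iff hne).1 (lt_add_of_pos_right (infDist y D) hε)
  have h1 := infDist_le_dist_of_mem (x := a • x + b • y) (hD hz hw ha hb hab)
  have h2 : dist (a • x + b • y) (a • z + b • w) ≤ a * dist x z + b * dist y w := by
    refine (dist_add_add_le _ _ _ _).trans ?_
    rw [dist_smul₀, dist_smul₀, Real.norm_of_nonneg ha, Real.norm_of_nonneg hb]
  have h3 := mul_le_mul_of_nonneg_left hz'.le ha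
  have h4 := mul_le_mul_of_nonneg_left hw'.le hb
  have h5 : a * ε + b * ε = ε := by rw [← add_mul, hab, one_mul]
  linarith

lemma aux_phi {Y : Type*} [NormedAddCommGroup Y] [NormedSpace ℝ Y] [CompleteSpace Y]
    (h : ¬ Function.Surjective (NormedSpace.inclusionInDoubleDual ℝ Y)) :
    ∃ φ : Y → ℝ, Continuous φ ∧ (∀ x y : Y, ∀ a b : ℝ, 0 ≤ a → 0 ≤ b → a + b = 1 →
      φ (a • x + b • y) ≤ a * φ x + b * φ y) ∧ (∀ y, 0 < φ y) ∧
      (∀ y, ‖y‖ ≤ 1 → φ y ≤ 1) ∧ ∀ ε > 0, ∃ y, ‖y‖ ≤ 1 ∧ φ y < ε := by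
  obtain ⟨θ, y, f, hθ, hy, hf, h0, h1⟩ := aux_seq_s14 h
  let A : Set (Y × ℝ) := Set.range fun n => (y n, (1 / 2 : ℝ) ^ n)
  let D : Set (Y × ℝ) := closure (convexHull ℝ A)
  have hAD : A ⊆ D := (subset_convexHull ℝ A).trans subset_closure
  have hDne : D.Nonempty := ⟨_, hAD ⟨0, rfl⟩⟩
  have hDc : Convex ℝ D := (convex_convexHull ℝ A).closure
  have hDcl : IsClosed D := isClosed_closure
  have hmem : ∀ z : Y, (z, (0 : ℝ)) ∉ D := by
    intro z hz
    have hk : ∀ k, θ ≤ f k z := by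
      intro k
      let L : StrongDual ℝ (Y × ℝ) := (f k).comp (ContinuousLinearMap.fst ℝ Y ℝ) +
        (θ * 2 ^ k) • ContinuousLinearMap.snd ℝ Y ℝ
      have hL : ∀ p : Y × ℝ, L p = f k p.1 + θ * 2 ^ k * p.2 := by
        intro p; simp [L]
      have hsub : D ⊆ {p | θ ≤ L p} := by
        refine closure_minimal (convexHull_min ?_ ?_) ?_
        · rintro _ ⟨n, rfl⟩
          show θ ≤ L _
          rw [hL]
          show θ ≤ f k (y n) + θ * 2 ^ k * (1 / 2) ^ n
          rcases le_or_gt k n with hkn | hkn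
          · have := h1 n k hkn
            have : 0 ≤ θ * 2 ^ k * (1 / 2) ^ n := by positivity
            linarith
          · rw [h0 n k hkn]
            have h5 : (1 : ℝ) ≤ 2 ^ k * (1 / 2) ^ n := by
              have : (2 : ℝ) ^ n ≤ 2 ^ k := pow_le_pow_right₀ (by norm_num) hkn.le
              calc (1 : ℝ) = 2 ^ n * (1 / 2) ^ n := by rw [← mul_pow]; norm_num
                _ ≤ 2 ^ k * (1 / 2) ^ n := by gcongr
            nlinarith
        · exact convex_halfSpace_ge L.toLinearMap.isLinear θ
        · exact isClosed_le continuous_const L.continuous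
      have := hsub hz
      simpa [hL] using this
    have hconv : Convex ℝ {p : Y × ℝ | ∃ m, ∀ k, m ≤ k → f k p.1 = 0} := by
      rintro p ⟨m, hm⟩ q ⟨m', hm'⟩ a b _ _ _
      refine ⟨max m m', fun k hk => ?_⟩
      simp [hm k (le_of_max_le_left hk), hm' k (le_of_max_le_right hk)]
    have hsub : convexHull ℝ A ⊆ {p : Y × ℝ | ∃ m, ∀ k, m ≤ k → f k p.1 = 0} := by
      refine convexHull_min ?_ hconv
      rintro _ ⟨n, rfl⟩
      exact ⟨n + 1, fun k hk => h0 n k hk⟩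
    obtain ⟨p, hp, hpd⟩ := Metric.mem_closure_iff.1 hz θ hθ
    obtain ⟨m, hm⟩ := hsub hp
    have h2 := hm m le_rfl
    have h3 := hk m
    have h4 : dist z p.1 < θ := (le_max_left _ _).trans_lt hpd
    have h5 : f m (z - p.1) ≤ ‖z - p.1‖ := by
      calc f m (z - p.1) ≤ ‖f m (z - p.1)‖ := Real.le_norm_self _
        _ ≤ ‖f m‖ * ‖z - p.1‖ := (f m).le_opNorm _
        _ ≤ 1 * ‖z - p.1‖ := by gcongr; exact hf m
        _ = _ := one_mul _
    rw [map_sub, h2] at h5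
    rw [dist_eq_norm] at h4
    linarith
  refine ⟨fun z => infDist (z, (0 : ℝ)) D / 2, ?_, ?_, ?_, ?_, ?_⟩
  · have := continuous_infDist_pt D
    fun_prop
  · intro x z a b ha hb hab
    have := aux_convex_infDist hDc hDne (x, (0 : ℝ)) (z, (0 : ℝ)) a b ha hb hab
    have h2 : a • (x, (0 : ℝ)) + b • (z, (0 : ℝ)) = (a • x + b • z, 0) := by simp
    rw [h2] at this
    show infDist _ D / 2 ≤ a * (infDist _ D / 2) + b * (infDist _ D / 2)
    linarith
  · intro z
    have := (hDcl.notMem_iff_infDist_pos hDne).1 (hmem z)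
    positivity
  · intro z hz
    have h2 := infDist_le_dist_of_mem (x := (z, (0 : ℝ))) (hAD ⟨0, rfl⟩)
    have h3 : dist (z, (0 : ℝ)) (y 0, (1 / 2 : ℝ) ^ 0) ≤ 2 := by
      rw [Prod.dist_eq]
      refine max_le ?_ ?_
      · rw [dist_eq_norm]
        have := norm_sub_le z (y 0)
        have := hy 0
        show ‖z - y 0‖ ≤ 2
        linarith
      · simp
    show infDist _ D / 2 ≤ 1
    have := h2.trans h3
    linarith
  · intro ε hε
    obtain ⟨n, hn⟩ := exists_pow_lt_of_lt_one hε (by norm_num : (1 / 2 : ℝ) < 1)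
    refine ⟨y n, hy n, ?_⟩
    have h2 := infDist_le_dist_of_mem (x := (y n, (0 : ℝ))) (hAD ⟨n, rfl⟩)
    have h3 : dist (y n, (0 : ℝ)) (y n, (1 / 2 : ℝ) ^ n) = (1 / 2) ^ n := by
      rw [Prod.dist_eq]
      simp
    show infDist _ D / 2 < ε
    have h4 := h2.trans h3.le
    have : (0 : ℝ) < (1 / 2) ^ n := by positivity
    linarith

lemma aux_nonrefl {X Y V : Type*} [NormedAddCommGroup X] [NormedSpace ℝ X]
    [NormedAddCommGroup Y] [NormedSpace ℝ Y] [NormedAddCommGroup V] [NormedSpace ℝ V]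
    [FiniteDimensional ℝ V] (hX : ¬ Function.Surjective (NormedSpace.inclusionInDoubleDual ℝ X))
    (ι : Y →L[ℝ] X) (P : X →L[ℝ] Y) (Q : X →L[ℝ] V) (σ : V →L[ℝ] X)
    (hdec : ∀ x, ι (P x) + σ (Q x) = x) :
    ¬ Function.Surjective (NormedSpace.inclusionInDoubleDual ℝ Y) := by
  intro hY
  refine hX fun F => ?_
  let Pt : StrongDual ℝ Y →L[ℝ] StrongDual ℝ X := (ContinuousLinearMap.compL ℝ X Y ℝ).flip P
  have hPt : ∀ h, Pt h = h.comp P := fun h => rfl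
  obtain ⟨y, hy⟩ := hY (F.comp Pt)
  let ψ : Module.Dual ℝ (Module.Dual ℝ V) :=
    { toFun := fun g => F ((LinearMap.toContinuousLinearMap g).comp Q)
      map_add' := by
        intro a b
        rw [map_add, ContinuousLinearMap.add_comp, map_add]
      map_smul' := by
        intro c a
        rw [map_smul, ContinuousLinearMap.smul_comp, map_smul]; rfl }
  obtain ⟨e, he⟩ := (Module.evalEquiv ℝ V).surjective ψ
  refine ⟨ι y + σ e, ?_⟩
  ext f
  have h1 : f (ι y) = F ((f.comp ι).comp P) := by
    have := congrArg (fun L : StrongDual ℝ (StrongDual ℝ Y) => L (f.comp ι)) hy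
    exact this
  have h2 : f (σ e) = F ((f.comp σ).comp Q) := by
    have := congrArg (fun L => L ((f.comp σ : V →L[ℝ] ℝ) : V →ₗ[ℝ] ℝ)) he
    exact this
  rw [NormedSpace.dual_def, map_add, h1, h2, ← map_add]
  congr 1
  ext x
  show f (ι (P x)) + f (σ (Q x)) = f x
  rw [← map_add, hdec]

/-- The compact planar set (times a ball). -/
def auxK (W : Type*) [NormedAddCommGroup W] : Set (ℝ × ℝ × W) :=
  {q | |q.2.1| ≤ 1 ∧ q.1 - 1 ≤ √(1 - q.2.1) ∧ -q.1 - 1 ≤ √(1 + q.2.1) ∧ ‖q.2.2‖ ≤ 1}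

lemma auxK_neg {W : Type*} [NormedAddCommGroup W] {q : ℝ × ℝ × W} (hq : q ∈ auxK W) :
    -q ∈ auxK W := by
  obtain ⟨h1, h2, h3, h4⟩ := hq
  refine ⟨?_, ?_, ?_, ?_⟩
  · simpa using h1
  · simpa using h3
  · simpa [sub_eq_add_neg] using h2
  · simpa using h4

lemma auxK_bound {W : Type*} [NormedAddCommGroup W] {q : ℝ × ℝ × W} (hq : q ∈ auxK W) :
    ‖q‖ ≤ 3 := by
  obtain ⟨h1, h2, h3, h4⟩ := hq
  have h5 := abs_le.1 h1
  have a1 : √(1 - q.2.1) ≤ 2 := by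
    rw [Real.sqrt_le_left (by norm_num)]; linarith
  have a2 : √(1 + q.2.1) ≤ 2 := by
    rw [Real.sqrt_le_left (by norm_num)]; linarith
  refine max_le ?_ (max_le ?_ ?_)
  · rw [Real.norm_eq_abs, abs_le]; constructor <;> linarith
  · rw [Real.norm_eq_abs]; linarith
  · linarith

lemma auxK_closed {W : Type*} [NormedAddCommGroup W] : IsClosed (auxK W) := by
  have a1 : IsClosed {q : ℝ × ℝ × W | |q.2.1| ≤ 1} := isClosed_le (by fun_prop) (by fun_prop)
  have a2 : IsClosed {q : ℝ × ℝ × W | q.1 - 1 ≤ √(1 - q.2.1)} :=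
    isClosed_le (by fun_prop) (by fun_prop)
  have a3 : IsClosed {q : ℝ × ℝ × W | -q.1 - 1 ≤ √(1 + q.2.1)} :=
    isClosed_le (by fun_prop) (by fun_prop)
  have a4 : IsClosed {q : ℝ × ℝ × W | ‖q.2.2‖ ≤ 1} := isClosed_le (by fun_prop) (by fun_prop)
  exact a1.inter (a2.inter (a3.inter a4))

lemma aux_sqrt {a b u v : ℝ} (ha : 0 ≤ a) (hb : 0 ≤ b) (hab : a + b = 1) (hu : 0 ≤ u)
    (hv : 0 ≤ v) : a * √u + b * √v ≤ √(a * u + b * v) := by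
  have := Real.strictConcaveOn_sqrt.concaveOn.2 (x := u) hu (y := v) hv ha hb hab
  simpa using this

lemma auxK_convex {W : Type*} [NormedAddCommGroup W] [NormedSpace ℝ W] :
    Convex ℝ (auxK W) := by
  rintro ⟨s, t, w⟩ ⟨h1, h2, h3, h4⟩ ⟨s', t', w'⟩ ⟨h1', h2', h3', h4'⟩ a b ha hb hab
  simp only at h1 h2 h3 h4 h1' h2' h3' h4'
  have g1 := abs_le.1 h1
  have g1' := abs_le.1 h1'
  have e1 : 1 - (a * t + b * t') = a * (1 - t) + b * (1 - t') := by linear_combination -hab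
  have e2 : 1 + (a * t + b * t') = a * (1 + t) + b * (1 + t') := by linear_combination -hab
  have k1 := aux_sqrt ha hb hab (u := 1 - t) (v := 1 - t') (by linarith) (by linarith)
  have k2 := aux_sqrt ha hb hab (u := 1 + t) (v := 1 + t') (by linarith) (by linarith)
  rw [← e1] at k1
  rw [← e2] at k2
  refine ⟨?_, ?_, ?_, ?_⟩
  · show |a * t + b * t'| ≤ 1
    rw [abs_le]; constructor <;> nlinarith
  · show a * s + b * s' - 1 ≤ √(1 - (a * t + b * t'))
    nlinarith
  · show -(a * s + b * s') - 1 ≤ √(1 + (a * t + b * t'))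
    nlinarith
  · show ‖a • w + b • w'‖ ≤ 1
    have := (convex_closedBall (0 : W) 1) (x := w) (by simpa using h4) (y := w')
      (by simpa using h4') ha hb hab
    simpa using this

lemma auxK_max1 {W : Type*} [NormedAddCommGroup W] [NormedSpace ℝ W]
    (L : ℝ × ℝ × W →ₗ[ℝ] ℝ) (w : W) (hq : ((1 : ℝ), (1 : ℝ), w) ∈ auxK W)
    (hmax : ∀ z ∈ auxK W, L z ≤ L (1, 1, w)) :
    ((0 : ℝ), (1 : ℝ), w) ∈ auxK W ∧ L (1, 1, w) ≤ L (0, 1, w) := by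
  have hL : ∀ s t : ℝ, L (s, t, w) = s * L (1, 0, 0) + t * L (0, 1, 0) + L (0, 0, w) := by
    intro s t
    have : (s, t, w) = s • ((1 : ℝ), (0 : ℝ), (0 : W)) + t • ((0 : ℝ), (1 : ℝ), (0 : W))
        + ((0 : ℝ), (0 : ℝ), w) := by simp
    rw [this, map_add, map_add, map_smul, map_smul, smul_eq_mul, smul_eq_mul]
  have hw : ‖w‖ ≤ 1 := hq.2.2.2
  have hr : ∀ r : ℝ, 0 < r → r ≤ 1 → L (1, 0, 0) ≤ r * L (0, 1, 0) := by
    intro r h0 h1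
    have hm : ((1 + r : ℝ), (1 - r ^ 2 : ℝ), w) ∈ auxK W := by
      refine ⟨?_, ?_, ?_, hw⟩
      · show |1 - r ^ 2| ≤ 1
        rw [abs_le]; constructor <;> nlinarith
      · show 1 + r - 1 ≤ √(1 - (1 - r ^ 2))
        apply Real.le_sqrt_of_sq_le
        nlinarith
      · show -(1 + r) - 1 ≤ √(1 + (1 - r ^ 2))
        have := Real.sqrt_nonneg (1 + (1 - r ^ 2))
        linarith
    have h2 := hmax _ hm
    rw [hL, hL 1 1] at h2
    have : r * L (1, 0, 0) ≤ r * (r * L (0, 1, 0)) := by nlinarith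
    exact le_of_mul_le_mul_left this h0
  have hα : L (1, 0, 0) ≤ 0 := by
    by_contra hc
    push Not at hc
    have hb : 0 < L (0, 1, 0) := by
      have := hr 1 one_pos le_rfl
      linarith
    have := hr (min 1 (L (1, 0, 0) / (2 * L (0, 1, 0)))) (by positivity) (min_le_left _ _)
    have h3 : min 1 (L (1, 0, 0) / (2 * L (0, 1, 0))) * L (0, 1, 0)
        ≤ L (1, 0, 0) / (2 * L (0, 1, 0)) * L (0, 1, 0) := by
      gcongr
      exact min_le_right _ _
    have h4 : L (1, 0, 0) / (2 * L (0, 1, 0)) * L (0, 1, 0) = L (1, 0, 0) / 2 := by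
      field_simp
    linarith
  refine ⟨⟨by simp, ?_, ?_, hw⟩, ?_⟩
  · show (0 : ℝ) - 1 ≤ √(1 - 1)
    simp
  · show -(0 : ℝ) - 1 ≤ √(1 + 1)
    have := Real.sqrt_nonneg ((1 : ℝ) + 1)
    linarith
  · rw [hL 1 1, hL 0 1]; linarith

lemma auxK_max {W : Type*} [NormedAddCommGroup W] [NormedSpace ℝ W] [FiniteDimensional ℝ W]
    (L : ℝ × ℝ × W →L[ℝ] ℝ) :
    ∃ q ∈ auxK W, ¬ (q.1 = 1 ∧ q.2.1 = 1) ∧ ¬ (q.1 = -1 ∧ q.2.1 = -1) ∧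
      ∀ z ∈ auxK W, L z ≤ L q := by
  have : ProperSpace W := FiniteDimensional.proper ℝ W
  have hc : IsCompact (auxK W) := Metric.isCompact_of_isClosed_isBounded auxK_closed
    ((isBounded_iff_forall_norm_le).2 ⟨3, fun q hq => auxK_bound hq⟩)
  have hne : (auxK W).Nonempty := ⟨0, by simp, by simp, by simp, by simp⟩
  obtain ⟨⟨s, t, w⟩, hq, hmax⟩ := hc.exists_isMaxOn hne L.continuous.continuousOn
  have hmax' : ∀ z ∈ auxK W, L z ≤ L (s, t, w) := fun z hz => hmax hz
  by_cases h1 : s = 1 ∧ t = 1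
  · obtain ⟨rfl, rfl⟩ := h1
    obtain ⟨h2, h3⟩ := auxK_max1 L.toLinearMap w hq hmax'
    refine ⟨_, h2, by simp, by norm_num, fun z hz => (hmax' z hz).trans h3⟩
  by_cases h2 : s = -1 ∧ t = -1
  · obtain ⟨rfl, rfl⟩ := h2
    have hq' : ((1 : ℝ), (1 : ℝ), -w) ∈ auxK W := by simpa using auxK_neg hq
    have hn : ((1 : ℝ), (1 : ℝ), -w) = -((-1 : ℝ), (-1 : ℝ), w) := by simp
    obtain ⟨h2, h3⟩ := auxK_max1 (-L.toLinearMap) (-w) hq' (by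
      intro z hz
      have := hmax' _ (auxK_neg hz)
      rw [hn]
      show -L z ≤ -L (-((-1 : ℝ), (-1 : ℝ), w))
      rw [map_neg] at this ⊢
      linarith)
    refine ⟨_, auxK_neg h2, by norm_num, by simp, fun z hz => (hmax' z hz).trans ?_⟩
    rw [hn] at h3
    replace h3 : -L (-((-1 : ℝ), (-1 : ℝ), w)) ≤ -L (0, 1, -w) := h3
    rw [map_neg] at h3 ⊢
    linarith
  exact ⟨_, hq, h1, h2, hmax'⟩

/-- The unit ball of the new norm. -/
def auxB {X Y W : Type*} [NormedAddCommGroup X] [NormedSpace ℝ X]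
    [NormedAddCommGroup Y] [NormedSpace ℝ Y] [NormedAddCommGroup W] [NormedSpace ℝ W]
    (P : X →L[ℝ] Y) (Q : X →L[ℝ] ℝ × ℝ × W) (φ : Y → ℝ) : Set X :=
  {x | ‖P x‖ ≤ 1 ∧ Q x ∈ auxK W ∧ φ (P x) ≤ 1 - (Q x).1 + 2 * √(1 - (Q x).2.1) ∧
    φ (-P x) ≤ 1 + (Q x).1 + 2 * √(1 + (Q x).2.1)}

lemma auxB_lift {Y W : Type*} [NormedAddCommGroup Y] [NormedAddCommGroup W]
    (φ : Y → ℝ) (hφ1 : ∀ y, ‖y‖ ≤ 1 → φ y ≤ 1)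
    (hφ2 : ∀ ε > 0, ∃ y, ‖y‖ ≤ 1 ∧ φ y < ε) (q : ℝ × ℝ × W) (hq : q ∈ auxK W)
    (h1 : ¬ (q.1 = 1 ∧ q.2.1 = 1)) (h2 : ¬ (q.1 = -1 ∧ q.2.1 = -1)) :
    ∃ y : Y, ‖y‖ ≤ 1 ∧ φ y ≤ 1 - q.1 + 2 * √(1 - q.2.1) ∧
      φ (-y) ≤ 1 + q.1 + 2 * √(1 + q.2.1) := by
  obtain ⟨g1, g2, g3, -⟩ := hq
  obtain ⟨s, t, w⟩ := q
  simp only at *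
  have g := abs_le.1 g1
  have n1 := Real.sqrt_nonneg (1 - t)
  have n2 := Real.sqrt_nonneg (1 + t)
  rcases le_total 0 s with hs | hs
  · have hpos : 0 < 1 - s + 2 * √(1 - t) := by
      rcases g.2.lt_or_eq with ht | rfl
      · have : 0 < √(1 - t) := Real.sqrt_pos.2 (by linarith)
        linarith
      · simp only [sub_self, Real.sqrt_zero] at g2 ⊢
        have : s ≠ 1 := fun h => h1 ⟨h, rfl⟩
        have : s < 1 := lt_of_le_of_ne (by linarith) this
        linarith
    obtain ⟨y, hy, hy'⟩ := hφ2 _ hpos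
    refine ⟨y, hy, hy'.le, ?_⟩
    have := hφ1 (-y) (by rwa [norm_neg])
    linarith
  · have hpos : 0 < 1 + s + 2 * √(1 + t) := by
      rcases g.1.lt_or_eq with ht | rfl
      · have : 0 < √(1 + t) := Real.sqrt_pos.2 (by linarith)
        linarith
      · simp only [add_neg_cancel, Real.sqrt_zero] at g3 ⊢
        have : s ≠ -1 := fun h => h2 ⟨h, rfl⟩
        have : -1 < s := lt_of_le_of_ne (by linarith) this.symm
        linarith
    obtain ⟨y, hy, hy'⟩ := hφ2 _ hpos
    refine ⟨-y, by rwa [norm_neg], ?_, by rw [neg_neg]; exact hy'.le⟩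
    have := hφ1 (-y) (by rwa [norm_neg])
    linarith

section
variable {X Y W : Type*} [NormedAddCommGroup X] [NormedSpace ℝ X]
    [NormedAddCommGroup Y] [NormedSpace ℝ Y] [NormedAddCommGroup W] [NormedSpace ℝ W]
    (P : X →L[ℝ] Y) (Q : X →L[ℝ] ℝ × ℝ × W) (φ : Y → ℝ)

lemma auxB_neg {x : X} (hx : x ∈ auxB P Q φ) : -x ∈ auxB P Q φ := by
  obtain ⟨h1, h2, h3, h4⟩ := hx
  refine ⟨?_, ?_, ?_, ?_⟩
  · simpa using h1
  · rw [map_neg]; exact auxK_neg h2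
  · simpa using h4
  · simpa [sub_eq_add_neg] using h3

lemma auxB_closed (hφ : Continuous φ) : IsClosed (auxB P Q φ) := by
  have a1 : IsClosed {x : X | ‖P x‖ ≤ 1} := isClosed_le (by fun_prop) (by fun_prop)
  have a3 : IsClosed {x : X | φ (P x) ≤ 1 - (Q x).1 + 2 * √(1 - (Q x).2.1)} :=
    isClosed_le (by fun_prop) (by fun_prop)
  have a4 : IsClosed {x : X | φ (-P x) ≤ 1 + (Q x).1 + 2 * √(1 + (Q x).2.1)} :=
    isClosed_le (by fun_prop) (by fun_prop)
  exact a1.inter ((auxK_closed.preimage Q.continuous).inter (a3.inter a4))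

lemma auxB_nhds (hφ : Continuous φ) (hφ1 : ∀ y, ‖y‖ ≤ 1 → φ y ≤ 1) :
    auxB P Q φ ∈ nhds (0 : X) := by
  have h0 : φ 0 ≤ 1 := hφ1 0 (by simp)
  have e1 : ∀ᶠ x : X in nhds 0, ‖P x‖ < 1 :=
    ContinuousAt.eventually_lt (by fun_prop) (by fun_prop) (by simp)
  have e2 : ∀ᶠ x : X in nhds 0, |(Q x).2.1| < 1 :=
    ContinuousAt.eventually_lt (by fun_prop) (by fun_prop) (by simp)
  have e3 : ∀ᶠ x : X in nhds 0, (Q x).1 - 1 < √(1 - (Q x).2.1) :=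
    ContinuousAt.eventually_lt (by fun_prop) (by fun_prop) (by simp)
  have e4 : ∀ᶠ x : X in nhds 0, -(Q x).1 - 1 < √(1 + (Q x).2.1) :=
    ContinuousAt.eventually_lt (by fun_prop) (by fun_prop) (by simp)
  have e5 : ∀ᶠ x : X in nhds 0, ‖(Q x).2.2‖ < 1 :=
    ContinuousAt.eventually_lt (by fun_prop) (by fun_prop) (by simp)
  have e6 : ∀ᶠ x : X in nhds 0, φ (P x) < 1 - (Q x).1 + 2 * √(1 - (Q x).2.1) :=
    ContinuousAt.eventually_lt (by fun_prop) (by fun_prop) (by simp; linarith)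
  have e7 : ∀ᶠ x : X in nhds 0, φ (-P x) < 1 + (Q x).1 + 2 * √(1 + (Q x).2.1) :=
    ContinuousAt.eventually_lt (by fun_prop) (by fun_prop) (by simp; linarith)
  filter_upwards [e1, e2, e3, e4, e5, e6, e7] with x a1 a2 a3 a4 a5 a6 a7
  exact ⟨a1.le, ⟨a2.le, a3.le, a4.le, a5.le⟩, a6.le, a7.le⟩

lemma auxB_convex (hφ : ∀ x y : Y, ∀ a b : ℝ, 0 ≤ a → 0 ≤ b → a + b = 1 →
      φ (a • x + b • y) ≤ a * φ x + b * φ y) : Convex ℝ (auxB P Q φ) := by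
  rintro x ⟨h1, h2, h3, h4⟩ x' ⟨h1', h2', h3', h4'⟩ a b ha hb hab
  have hP : P (a • x + b • x') = a • P x + b • P x' := by simp
  have hQ : Q (a • x + b • x') = a • Q x + b • Q x' := by simp
  have c3 := hφ (P x) (P x') a b ha hb hab
  have c4 := hφ (-P x) (-P x') a b ha hb hab
  have hK := auxK_convex h2 h2' ha hb hab
  have g1 := abs_le.1 h2.1
  have g1' := abs_le.1 h2'.1
  have e4 : a • -P x + b • -P x' = -(a • P x + b • P x') := by simp [add_comm]
  rw [e4] at c4
  show _ ∧ _ ∧ _ ∧ _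
  rw [hP, hQ]
  generalize Q x = q at *
  generalize Q x' = q' at *
  obtain ⟨s, t, w⟩ := q
  obtain ⟨s', t', w'⟩ := q'
  simp only at g1 g1' h3 h4 h3' h4'
  have e1 : 1 - (a * t + b * t') = a * (1 - t) + b * (1 - t') := by linear_combination -hab
  have e2 : 1 + (a * t + b * t') = a * (1 + t) + b * (1 + t') := by linear_combination -hab
  have k1 := aux_sqrt ha hb hab (u := 1 - t) (v := 1 - t') (by linarith) (by linarith)
  have k2 := aux_sqrt ha hb hab (u := 1 + t) (v := 1 + t') (by linarith) (by linarith)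
  rw [← e1] at k1
  rw [← e2] at k2
  refine ⟨?_, hK, ?_, ?_⟩
  · have := (convex_closedBall (0 : Y) 1) (x := P x) (by simpa using h1) (y := P x')
      (by simpa using h1') ha hb hab
    simpa using this
  · show _ ≤ 1 - (a * s + b * s') + 2 * √(1 - (a * t + b * t'))
    have := mul_le_mul_of_nonneg_left h3 ha
    have := mul_le_mul_of_nonneg_left h3' hb
    nlinarith
  · show _ ≤ 1 + (a * s + b * s') + 2 * √(1 + (a * t + b * t'))
    have := mul_le_mul_of_nonneg_left h4 ha
    have := mul_le_mul_of_nonneg_left h4' hb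
    nlinarith

end

lemma aux_main {X Y W : Type*} [NormedAddCommGroup X] [NormedSpace ℝ X]
    [NormedAddCommGroup Y] [NormedSpace ℝ Y] [NormedAddCommGroup W] [NormedSpace ℝ W]
    [FiniteDimensional ℝ W] (ι : Y →L[ℝ] X)
    (P : X →L[ℝ] Y) (Q : X →L[ℝ] ℝ × ℝ × W) (σ : (ℝ × ℝ × W) →L[ℝ] X)
    (hdec : ∀ x, ι (P x) + σ (Q x) = x) (hPi : ∀ y, P (ι y) = y) (hPs : ∀ v, P (σ v) = 0)
    (hQi : ∀ y, Q (ι y) = 0) (hQs : ∀ v, Q (σ v) = v)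
    (φ : Y → ℝ) (hc : Continuous φ) (hconv : ∀ x y : Y, ∀ a b : ℝ, 0 ≤ a → 0 ≤ b → a + b = 1 →
      φ (a • x + b • y) ≤ a * φ x + b * φ y) (hpos : ∀ y, 0 < φ y)
    (hφ1 : ∀ y, ‖y‖ ≤ 1 → φ y ≤ 1) (hφ2 : ∀ ε > 0, ∃ y, ‖y‖ ≤ 1 ∧ φ y < ε) :
    ∃ N : X → ℝ, IsEquivNorm N ∧
      (∀ f : X →L[ℝ] ℝ, (∀ y ∈ Set.range ι, f y = 0) → AttainsWrt N f) ∧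
      ¬ ProximinalWrt N (Set.range ι) := by
  have hB0 : auxB P Q φ ∈ nhds (0 : X) := auxB_nhds P Q φ hc hφ1
  have hBc : Convex ℝ (auxB P Q φ) := auxB_convex P Q φ hconv
  have hBcl : IsClosed (auxB P Q φ) := auxB_closed P Q φ hc
  have hBn : ∀ x ∈ auxB P Q φ, -x ∈ auxB P Q φ := fun x hx => auxB_neg P Q φ hx
  have hlift : ∀ q ∈ auxK W, ¬ (q.1 = 1 ∧ q.2.1 = 1) → ¬ (q.1 = -1 ∧ q.2.1 = -1) →
      ∃ x ∈ auxB P Q φ, Q x = q := by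
    intro q hq h1 h2
    obtain ⟨y, hy, hy1, hy2⟩ := auxB_lift φ hφ1 hφ2 q hq h1 h2
    have hQ : Q (ι y + σ q) = q := by rw [map_add, hQi, hQs, zero_add]
    have hP : P (ι y + σ q) = y := by rw [map_add, hPi, hPs, add_zero]
    refine ⟨ι y + σ q, ?_, hQ⟩
    show _ ∧ _ ∧ _ ∧ _
    rw [hQ, hP]
    exact ⟨hy, hq, hy1, hy2⟩
  set B := auxB P Q φ with hB
  have hBa : Absorbent ℝ B := absorbent_nhds_zero hB0
  have hle : ∀ x, gauge B x ≤ 1 ↔ x ∈ B := by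
    intro x
    rw [gauge_le_one_iff_mem_closure hBc hB0, hBcl.closure_eq]
  have hsm : ∀ (c : ℝ) (x : X), gauge B (c • x) = |c| * gauge B x := by
    intro c x
    rcases le_total 0 c with h | h
    · rw [gauge_smul_of_nonneg h, abs_of_nonneg h, smul_eq_mul]
    · rw [abs_of_nonpos h, ← smul_eq_mul, ← gauge_smul_of_nonneg (by linarith : 0 ≤ -c),
        neg_smul, gauge_neg hBn]
  refine ⟨gauge B, ⟨gauge_add_le hBc hBa, hsm, ?_⟩, ?_, ?_⟩
  · obtain ⟨r, hr, hrB⟩ := Metric.mem_nhds_iff.1 hB0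
    have hbd : B ⊆ closedBall 0 (‖ι‖ + ‖σ‖ * 3 + 1) := by
      intro x hx
      rw [mem_closedBall_zero_iff]
      calc ‖x‖ = ‖ι (P x) + σ (Q x)‖ := by rw [hdec]
        _ ≤ ‖ι (P x)‖ + ‖σ (Q x)‖ := norm_add_le _ _
        _ ≤ ‖ι‖ * ‖P x‖ + ‖σ‖ * ‖Q x‖ := add_le_add (ι.le_opNorm _) (σ.le_opNorm _)
        _ ≤ ‖ι‖ * 1 + ‖σ‖ * 3 := by
          gcongr
          · exact hx.1
          · exact auxK_bound hx.2.1
        _ ≤ _ := by linarith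
    have hR : 0 < ‖ι‖ + ‖σ‖ * 3 + 1 := by positivity
    refine ⟨(‖ι‖ + ‖σ‖ * 3 + 1)⁻¹, r⁻¹, by positivity, fun x => ⟨?_, ?_⟩⟩
    · have := le_gauge_of_subset_closedBall (x := x) hBa hR.le hbd
      rwa [div_eq_inv_mul] at this
    · have := mul_gauge_le_norm (x := x) hrB
      rw [← div_eq_inv_mul, le_div_iff₀ hr, mul_comm]
      exact this
  · intro f hf
    have hfQ : ∀ x, f x = (f.comp σ) (Q x) := by
      intro x
      conv_lhs => rw [← hdec x]
      rw [map_add, hf _ ⟨_, rfl⟩, zero_add]; rfl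
    obtain ⟨q, hq, h1, h2, hmax⟩ := auxK_max (f.comp σ)
    obtain ⟨x, hx, hxq⟩ := hlift q hq h1 h2
    refine ⟨x, (hle x).2 hx, ?_⟩
    symm
    refine IsGreatest.csSup_eq ⟨⟨x, (hle x).2 hx, rfl⟩, ?_⟩
    rintro _ ⟨z, hz, rfl⟩
    have hz' : z ∈ B := (hle z).1 hz
    show f z ≤ f x
    rw [hfQ z, hfQ x, hxq]
    exact hmax _ hz'.2.1
  · intro hprox
    obtain ⟨y, ⟨y', rfl⟩, hy⟩ := hprox (σ (1, 1, 0))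
    have hbb : BddBelow ((fun z => gauge B (σ (1, 1, 0) - z)) '' Set.range ι) := by
      refine ⟨0, ?_⟩
      rintro _ ⟨z, _, rfl⟩
      exact gauge_nonneg _
    have hinf : ∀ l : ℝ, 0 < l → l < 1 →
        sInf ((fun z => gauge B (σ (1, 1, 0) - z)) '' Set.range ι) ≤ l⁻¹ := by
      intro l h0 h1
      have hm : ((l : ℝ), (l : ℝ), (0 : W)) ∈ auxK W := by
        refine ⟨?_, ?_, ?_, by simp⟩
        · show |l| ≤ 1
          rw [abs_le]; constructor <;> linarith
        · show l - 1 ≤ √(1 - l)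
          have := Real.sqrt_nonneg (1 - l); linarith
        · show -l - 1 ≤ √(1 + l)
          have := Real.sqrt_nonneg (1 + l); linarith
      obtain ⟨x, hx, hxq⟩ := hlift _ hm (fun h => h1.ne h.1) (fun h => by
        have : l = -1 := h.1
        linarith)
      refine (csInf_le hbb ⟨ι (-(l⁻¹ • P x)), ⟨_, rfl⟩, rfl⟩).trans ?_
      have he : σ (1, 1, 0) - ι (-(l⁻¹ • P x)) = l⁻¹ • x := by
        have : ((1 : ℝ), (1 : ℝ), (0 : W)) = l⁻¹ • Q x := by
          rw [hxq]; simp [h0.ne']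
        rw [this, map_smul, map_neg, map_smul, sub_neg_eq_add, add_comm, ← smul_add, hdec]
      show gauge B (σ (1, 1, 0) - ι (-(l⁻¹ • P x))) ≤ l⁻¹
      rw [he, hsm, abs_of_pos (inv_pos.2 h0)]
      have := (hle x).2 hx
      have h3 : 0 < l⁻¹ := inv_pos.2 h0
      nlinarith
    have h1 : gauge B (σ (1, 1, 0) - ι y') ≤ 1 := by
      rw [hy]
      refine le_of_forall_gt_imp_ge_of_dense fun a ha => ?_
      have := hinf a⁻¹ (inv_pos.2 (by linarith)) (inv_lt_one_of_one_lt₀ ha)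
      rwa [inv_inv] at this
    have h2 := (hle _).1 h1
    have h3 : Q (σ (1, 1, 0) - ι y') = (1, 1, 0) := by rw [map_sub, hQs, hQi, sub_zero]
    have h4 := h2.2.2.1
    rw [h3] at h4
    have h5 := hpos (P (σ (1, 1, 0) - ι y'))
    simp only [sub_self, Real.sqrt_zero, mul_zero, add_zero] at h4
    linarith

end AuxSec

/-- Let `X` be a non-reflexive Banach space and `Y ⊆ X` a closed linear
subspace of finite codimension `d ≥ 2`.  Then `X` admits an equivalent norm `N` such that,
with respect to `N`, `Y⊥ ⊆ NA(X)` but `Y` is not proximinal in `X`. -/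
theorem stmt14 {X : Type*} [NormedAddCommGroup X] [NormedSpace ℝ X] [CompleteSpace X]
    (hnonrefl : ¬ Function.Surjective (NormedSpace.inclusionInDoubleDual ℝ X))
    (Y : Submodule ℝ X) [IsClosed (Y : Set X)] [FiniteDimensional ℝ (X ⧸ Y)]
    (hd : 2 ≤ Module.finrank ℝ (X ⧸ Y)) :
    ∃ N : X → ℝ, IsEquivNorm N ∧
      (∀ f : X →L[ℝ] ℝ, (∀ y ∈ Y, f y = 0) → AttainsWrt N f) ∧
      ¬ ProximinalWrt N (Y : Set X) := by
  obtain ⟨k, hk⟩ := Nat.exists_eq_add_of_le hd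
  have hfr : Module.finrank ℝ (X ⧸ Y) = Module.finrank ℝ (ℝ × ℝ × (Fin k → ℝ)) := by
    rw [hk]; simp; ring
  let e : (X ⧸ Y) ≃ₗ[ℝ] (ℝ × ℝ × (Fin k → ℝ)) := LinearEquiv.ofFinrankEq _ _ hfr
  let Q : X →L[ℝ] (ℝ × ℝ × (Fin k → ℝ)) :=
    (LinearMap.toContinuousLinearMap e.toLinearMap).comp Y.mkQL
  have hQ : ∀ x, Q x = e (Y.mkQ x) := fun x => rfl
  have hsurj : Function.Surjective Q := by
    intro v
    obtain ⟨x, hx⟩ := Y.mkQ_surjective (e.symm v)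
    exact ⟨x, by rw [hQ, hx, e.apply_symm_apply]⟩
  obtain ⟨σ0, hσ0⟩ := Q.toLinearMap.exists_rightInverse_of_surjective
    (LinearMap.range_eq_top.2 hsurj)
  let σ : (ℝ × ℝ × (Fin k → ℝ)) →L[ℝ] X := LinearMap.toContinuousLinearMap σ0
  have hQs : ∀ v, Q (σ v) = v := fun v => LinearMap.congr_fun hσ0 v
  have hQY : ∀ x, Q x = 0 ↔ x ∈ Y := by
    intro x
    rw [hQ, e.map_eq_zero_iff, Submodule.mkQ_apply, Submodule.Quotient.mk_eq_zero]
  let P : X →L[ℝ] Y := (ContinuousLinearMap.id ℝ X - σ.comp Q).codRestrict Y (by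
    intro x
    rw [← hQY]
    show Q (x - σ (Q x)) = 0
    rw [map_sub, hQs, sub_self])
  have hP : ∀ x, (P x : X) = x - σ (Q x) := fun x => rfl
  have hdec : ∀ x, Y.subtypeL (P x) + σ (Q x) = x := by
    intro x
    show (P x : X) + _ = x
    rw [hP, sub_add_cancel]
  have hQi : ∀ y : Y, Q (Y.subtypeL y) = 0 := fun y => (hQY _).2 y.2
  have hPi : ∀ y : Y, P (Y.subtypeL y) = y := by
    intro y
    apply Subtype.ext
    rw [hP, hQi, map_zero, sub_zero]; rfl
  have hPs : ∀ v, P (σ v) = 0 := by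
    intro v
    apply Subtype.ext
    rw [hP, hQs, sub_self]; rfl
  have hYc : CompleteSpace Y := (‹IsClosed (Y : Set X)›).completeSpace_coe
  obtain ⟨φ, hφ1, hφ2, hφ3, hφ4, hφ5⟩ := aux_phi (aux_nonrefl hnonrefl Y.subtypeL P Q σ hdec)
  obtain ⟨N, h1, h2, h3⟩ := aux_main Y.subtypeL P Q σ hdec hPi hPs hQi hQs φ hφ1 hφ2 hφ3 hφ4 hφ5
  have hr : Set.range Y.subtypeL = (Y : Set X) := by
    ext x; simp
  rw [hr] at h2 h3
  exact ⟨N, h1, h2, h3⟩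
end
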